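/- Assume A and A₀ satisfy Hypothesis (H). For z ∈ ℂ \ closure(−t₀ + S_{ω₀}), let D(z) denote the closure of (A − zI)^{1/2}(A₀ − zI)^{-1}(A − zI)^{1/2}; then D(z) − I is trace class, so det_H(D(z)) is well defined. For every z ∈ ℂ \ closure(−t₀ + S_{ω₀}) at which D(z) is boundedly invertible, −(d/dz) ln det_H(D(z)) = tr_H((A − zI)^{-1} − (A₀ − zI)^{-1}). -/

import Mathlib

open MeasureTheory Filter
open scoped InnerProductSpace

noncomputable section
open scoped Classical


variable {H : Type*} [NormedAddCommGroup H] [InnerProductSpace ℂ H] [CompleteSpace H]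

/-- `T` is the (bounded, everywhere defined) inverse of `A - z·I`. -/
def IsResolvent (A : H →ₗ.[ℂ] H) (z : ℂ) (T : H →L[ℂ] H) : Prop :=
  (∀ x : H, ∃ hx : T x ∈ A.domain, A ⟨T x, hx⟩ - z • T x = x) ∧
  ∀ u : A.domain, T (A u - z • (u : H)) = (u : H)

/-- The resolvent set of an unbounded operator. -/
def resolventSetP (A : H →ₗ.[ℂ] H) : Set ℂ := {z | ∃ T, IsResolvent A z T}

/-- The spectrum of an unbounded operator. -/
def specP (A : H →ₗ.[ℂ] H) : Set ℂ := (resolventSetP A)ᶜ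

/-- The resolvent `(A - z·I)⁻¹` (junk value `0` off the resolvent set). -/
def res (A : H →ₗ.[ℂ] H) (z : ℂ) : H →L[ℂ] H :=
  if h : ∃ T, IsResolvent A z T then h.choose else 0

/-- The operator `A + t·I` (same domain). -/
def shiftP (A : H →ₗ.[ℂ] H) (t : ℂ) : H →ₗ.[ℂ] H :=
  ⟨A.domain, A.toFun + t • A.domain.subtype⟩

/-- `A` is of positive type: `(-∞,0] ⊆ ρ(A)` and `sup_{t ≥ 0} ‖(1+t)(A+t)⁻¹‖ < ∞`. -/
def IsPositiveTypeP (A : H →ₗ.[ℂ] H) : Prop :=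
  (∀ x : ℝ, x ≤ 0 → (x : ℂ) ∈ resolventSetP A) ∧
  ∃ M : ℝ, ∀ t : ℝ, 0 ≤ t → (1 + t) * ‖res A (-(t : ℂ))‖ ≤ M

/-- The open sector of half-opening angle `ω` about the positive reals
(`(0,∞)` for `ω = 0`). -/
def sectorS (ω : ℝ) : Set ℂ :=
  if ω = 0 then (fun x : ℝ => (x : ℂ)) '' Set.Ioi 0
  else {z : ℂ | z ≠ 0 ∧ |Complex.arg z| < ω}

/-- `A` is sectorial of angle `ω`. -/
def IsSectorialP (A : H →ₗ.[ℂ] H) (ω : ℝ) : Prop :=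
  specP A ⊆ closure (sectorS ω) ∧
  ∀ ω' : ℝ, ω < ω' → ω' < Real.pi →
    ∃ M : ℝ, ∀ z ∈ (closure (sectorS ω'))ᶜ, ‖z‖ * ‖res A z‖ ≤ M

/-- The shifted sector `-t₀ + S_ω`. -/
def shiftedSector (t0 ω : ℝ) : Set ℂ := (fun w => -(t0 : ℂ) + w) '' sectorS ω

/-- The region `ℂ \ closure (-t₀ + S_ω)`. -/
def offSector (t0 ω : ℝ) : Set ℂ := (closure (shiftedSector t0 ω))ᶜ

/-- The bounded operator `(A - z·I)^{-1/2}`, defined by the Balakrishnan-type formula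
`(1/π) ∫₀^∞ t^{-1/2} (A + (t - z)·I)⁻¹ dt`. -/
def negSqrt (A : H →ₗ.[ℂ] H) (z : ℂ) : H →L[ℂ] H :=
  ((Real.pi : ℂ))⁻¹ • ∫ t in Set.Ioi (0 : ℝ), ((Real.sqrt t : ℂ))⁻¹ • res A (z - t)

/-- Trace-class (nuclear) bounded operators, characterized by
`sup { ∑ |⟨eᵢ, T fᵢ⟩| : (eᵢ), (fᵢ) finite orthonormal families } < ∞`. -/
def IsTraceClass (T : H →L[ℂ] H) : Prop :=
  ∃ C : ℝ, ∀ (n : ℕ) (e f : Fin n → H), Orthonormal ℂ e → Orthonormal ℂ f →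
    ∑ i, ‖⟪e i, T (f i)⟫_ℂ‖ ≤ C

/-- The trace norm `‖T‖₁`. -/
def traceNorm (T : H →L[ℂ] H) : ℝ :=
  sSup {s : ℝ | ∃ (n : ℕ) (e f : Fin n → H), Orthonormal ℂ e ∧ Orthonormal ℂ f ∧
    s = ∑ i, ‖⟪e i, T (f i)⟫_ℂ‖}

/-- The trace of a (trace-class) operator, computed in the Hilbert basis `b`. -/
def traceH (b : HilbertBasis ℕ ℂ H) (T : H →L[ℂ] H) : ℂ :=
  ∑' n, ⟪(b n : H), T (b n)⟫_ℂ

/-- The Fredholm determinant `det (I + T)` (for `T` trace class), computed as the limit of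
finite-section determinants along the Hilbert basis `b`. -/
def detI (b : HilbertBasis ℕ ℂ H) (T : H →L[ℂ] H) : ℂ :=
  limUnder atTop fun F : Finset ℕ =>
    Matrix.det (Matrix.of fun i j : F =>
      (if (i : ℕ) = (j : ℕ) then (1 : ℂ) else 0) + ⟪(b (i : ℕ) : H), T (b (j : ℕ))⟫_ℂ)


/-- Hypothesis (H) of Section 7: `A, A₀` densely defined and closed; `A + t₀`, `A₀ + t₀`
of positive type and sectorial of angle `ω₀ ∈ [0,π)`；for some `t₁ ≥ t₀` the square-root
domain inclusions hold and the closure of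
`(A + t₁)^{1/2}[(A + t₁)⁻¹ - (A₀ + t₁)⁻¹](A + t₁)^{1/2}` is trace class (the closure `D₁`
being characterized by `(A + t₁)^{-1/2} D₁ (A + t₁)^{-1/2} = (A + t₁)⁻¹ - (A₀ + t₁)⁻¹`). -/
def HypothesisH (A A0 : H →ₗ.[ℂ] H) (t0 ω0 t1 : ℝ) : Prop :=
  Dense (A.domain : Set H) ∧ Dense (A0.domain : Set H) ∧
  IsClosed (A.graph : Set (H × H)) ∧ IsClosed (A0.graph : Set (H × H)) ∧
  0 ≤ ω0 ∧ ω0 < Real.pi ∧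
  IsPositiveTypeP (shiftP A (t0 : ℂ)) ∧ IsPositiveTypeP (shiftP A0 (t0 : ℂ)) ∧
  IsSectorialP (shiftP A (t0 : ℂ)) ω0 ∧ IsSectorialP (shiftP A0 (t0 : ℂ)) ω0 ∧
  t0 ≤ t1 ∧
  Set.range (negSqrt A0 (-(t1 : ℂ))) ⊆ Set.range (negSqrt A (-(t1 : ℂ))) ∧
  Set.range (negSqrt A0.adjoint (-(t1 : ℂ))) ⊆ Set.range (negSqrt A.adjoint (-(t1 : ℂ))) ∧
  ∃ D1 : H →L[ℂ] H, IsTraceClass D1 ∧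
    (negSqrt A (-(t1 : ℂ))).comp (D1.comp (negSqrt A (-(t1 : ℂ)))) =
      res A (-(t1 : ℂ)) - res A0 (-(t1 : ℂ))


set_option linter.unusedSectionVars false

/-! ### Quantitative trace-class bounds -/

/-- `T` is trace class with trace norm at most `C`. -/
def TraceBound (T : H →L[ℂ] H) (C : ℝ) : Prop :=
  ∀ (n : ℕ) (e f : Fin n → H), Orthonormal ℂ e → Orthonormal ℂ f →
    ∑ i, ‖⟪e i, T (f i)⟫_ℂ‖ ≤ C

namespace TraceBound

theorem isTraceClass {T : H →L[ℂ] H} {C : ℝ} (h : TraceBound T C) : IsTraceClass T := ⟨C, h⟩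

theorem nonneg {T : H →L[ℂ] H} {C : ℝ} (h : TraceBound T C) : 0 ≤ C := by
  simpa using h 0 Fin.elim0 Fin.elim0 ⟨fun i => i.elim0, fun i => i.elim0⟩
    ⟨fun i => i.elim0, fun i => i.elim0⟩

theorem mono {T : H →L[ℂ] H} {C C' : ℝ} (h : TraceBound T C) (hC : C ≤ C') : TraceBound T C' :=
  fun n e f he hf => (h n e f he hf).trans hC

theorem zero : TraceBound (0 : H →L[ℂ] H) 0 := fun n e f _ _ => by simp

theorem add {S T : H →L[ℂ] H} {C C' : ℝ} (hS : TraceBound S C) (hT : TraceBound T C') :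
    TraceBound (S + T) (C + C') := fun n e f he hf => by
  refine le_trans ?_ (add_le_add (hS n e f he hf) (hT n e f he hf))
  rw [← Finset.sum_add_distrib]
  refine Finset.sum_le_sum fun i _ => ?_
  rw [add_apply, inner_add_right]
  exact norm_add_le _ _

theorem smul {T : H →L[ℂ] H} {C : ℝ} (hT : TraceBound T C) (c : ℂ) :
    TraceBound (c • T) (‖c‖ * C) := fun n e f he hf => by
  refine le_trans (le_of_eq ?_) (mul_le_mul_of_nonneg_left (hT n e f he hf) (norm_nonneg c))
  rw [Finset.mul_sum]
  refine Finset.sum_congr rfl fun i _ => ?_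
  rw [smul_apply, inner_smul_right, norm_mul]

theorem neg {T : H →L[ℂ] H} {C : ℝ} (hT : TraceBound T C) : TraceBound (-T) C := by
  simpa using hT.smul (-1)

theorem sub {S T : H →L[ℂ] H} {C C' : ℝ} (hS : TraceBound S C) (hT : TraceBound T C') :
    TraceBound (S - T) (C + C') := by
  simpa [sub_eq_add_neg] using hS.add hT.neg

theorem sum {ι : Type*} (s : Finset ι) {T : ι → H →L[ℂ] H} {C : ι → ℝ}
    (h : ∀ i ∈ s, TraceBound (T i) (C i)) : TraceBound (∑ i ∈ s, T i) (∑ i ∈ s, C i) := by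
  induction s using Finset.induction_on with
  | empty => simpa using zero
  | insert a s ha ih =>
    rw [Finset.sum_insert ha, Finset.sum_insert ha]
    exact (h a (Finset.mem_insert_self a s)).add
      (ih fun i hi => h i (Finset.mem_insert_of_mem hi))

theorem adjoint {T : H →L[ℂ] H} {C : ℝ} (hT : TraceBound T C) : TraceBound (star T) C :=
  fun n e f he hf => by
  refine le_trans (le_of_eq ?_) (hT n f e hf he)
  refine Finset.sum_congr rfl fun i _ => ?_
  rw [ContinuousLinearMap.star_eq_adjoint, ContinuousLinearMap.adjoint_inner_right,
    ← inner_conj_symm, RCLike.norm_conj]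

theorem unitary_mul {T : H →L[ℂ] H} {C : ℝ} (hT : TraceBound T C)
    (U : unitary (H →L[ℂ] H)) : TraceBound ((U : H →L[ℂ] H) * T) C := fun n e f he hf => by
  have hU : (U : H →L[ℂ] H) * star (U : H →L[ℂ] H) = 1 := Unitary.coe_mul_star_self U
  have he' : Orthonormal ℂ fun i => star (U : H →L[ℂ] H) (e i) := by
    rw [orthonormal_iff_ite] at he ⊢
    intro i j
    rw [← he i j, ContinuousLinearMap.star_eq_adjoint, ContinuousLinearMap.adjoint_inner_left,
      ← ContinuousLinearMap.star_eq_adjoint, ← mul_apply_eq_comp, hU,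
      one_apply_eq_self]
  refine le_trans (le_of_eq ?_) (hT n _ f he' hf)
  refine Finset.sum_congr rfl fun i _ => ?_
  rw [ContinuousLinearMap.star_eq_adjoint, ContinuousLinearMap.adjoint_inner_left,
    mul_apply_eq_comp]

theorem mul_left {T : H →L[ℂ] H} {C : ℝ} (hT : TraceBound T C) (X : H →L[ℂ] H) :
    TraceBound (X * T) (2 * ‖X‖ * C) := by
  obtain ⟨u, c, hX, hc⟩ := CStarAlgebra.exists_sum_four_unitary X
  have h : TraceBound (∑ i, c i • ((u i : H →L[ℂ] H) * T)) (∑ i, ‖c i‖ * C) :=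
    sum Finset.univ fun i _ => (hT.unitary_mul (u i)).smul (c i)
  have e : X * T = ∑ i, c i • ((u i : H →L[ℂ] H) * T) := by
    conv_lhs => rw [hX]
    simp [Finset.sum_mul]
  rw [e]
  refine h.mono ?_
  refine (Finset.sum_le_sum fun i _ => mul_le_mul_of_nonneg_right (hc i) hT.nonneg).trans
    (le_of_eq ?_)
  simp
  ring

theorem mul_right {T : H →L[ℂ] H} {C : ℝ} (hT : TraceBound T C) (X : H →L[ℂ] H) :
    TraceBound (T * X) (2 * ‖X‖ * C) := by
  simpa using (hT.adjoint.mul_left (star X)).adjoint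

theorem norm_le {T : H →L[ℂ] H} {C : ℝ} (hT : TraceBound T C) : ‖T‖ ≤ C := by
  refine ContinuousLinearMap.opNorm_le_bound _ hT.nonneg fun x => ?_
  rcases eq_or_ne x 0 with rfl | hx
  · simp
  rcases eq_or_ne (T x) 0 with hTx | hTx
  · rw [hTx, norm_zero]
    exact mul_nonneg hT.nonneg (norm_nonneg _)
  have hn : ∀ {y : H}, y ≠ 0 → Orthonormal ℂ (fun _ : Fin 1 => ((‖y‖⁻¹ : ℝ) : ℂ) • y) := by
    intro y hy
    refine ⟨fun i => ?_, fun i j hij => absurd (Subsingleton.elim i j) hij⟩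
    have := norm_pos_iff.2 hy
    rw [norm_smul, Complex.norm_real, norm_inv, norm_norm, inv_mul_cancel₀ this.ne']
  have h := hT 1 _ _ (hn hTx) (hn hx)
  have h1 := norm_pos_iff.2 hx
  have h2 := norm_pos_iff.2 hTx
  simp only [Finset.univ_unique, Finset.sum_singleton, map_smul, inner_smul_left,
    inner_smul_right, norm_mul, inner_self_eq_norm_sq_to_K, RCLike.norm_conj,
    Complex.norm_real, norm_inv, norm_norm, norm_pow] at h
  simp only [Complex.coe_algebraMap, Complex.norm_real, norm_norm] at h
  have e : ‖x‖⁻¹ * (‖T x‖⁻¹ * ‖T x‖ ^ 2) = ‖T x‖ / ‖x‖ := by field_simp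
  rw [e, div_le_iff₀ h1] at h
  exact h

/-- The defining estimate for families indexed by an arbitrary finite type. -/
theorem fintype {T : H →L[ℂ] H} {C : ℝ} (hT : TraceBound T C) {ι : Type*} [Fintype ι]
    {e f : ι → H} (he : Orthonormal ℂ e) (hf : Orthonormal ℂ f) :
    ∑ i, ‖⟪e i, T (f i)⟫_ℂ‖ ≤ C := by
  have q := Fintype.equivFin ι
  refine le_trans (le_of_eq ?_) (hT (Fintype.card ι) (e ∘ q.symm) (f ∘ q.symm)
    (he.comp _ q.symm.injective) (hf.comp _ q.symm.injective))
  exact (Equiv.sum_comp q.symm fun i => ‖⟪e i, T (f i)⟫_ℂ‖).symm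

end TraceBound

theorem TraceBound.of_tendsto {T : ℕ → H →L[ℂ] H} {S : H →L[ℂ] H} {C : ℝ}
    (h : ∀ k, TraceBound (T k) C) (hT : Tendsto T atTop (nhds S)) : TraceBound S C :=
  fun n e f he hf => by
  have hc : Continuous fun X : H →L[ℂ] H => ∑ i, ‖⟪e i, X (f i)⟫_ℂ‖ := by fun_prop
  exact le_of_tendsto ((hc.tendsto S).comp hT) (Eventually.of_forall fun k => h k n e f he hf)

/-- The positive part of a self-adjoint trace-class operator is trace class. -/
theorem TraceBound.cfc_max_zero {T : H →L[ℂ] H} {C : ℝ} (hT : TraceBound T C)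
    (hs : IsSelfAdjoint T) : TraceBound (cfc (fun x : ℝ => max x 0) T) (2 * C) := by
  let g : ℕ → ℝ → ℝ := fun k x => max 0 (min 1 ((k + 1) * x))
  have hg : ∀ k, Continuous (g k) := fun k => by fun_prop
  have hmul : ∀ k, cfc (g k) T * T = cfc (fun x => g k x * x) T := fun k => by
    conv_lhs => rw [← cfc_id' ℝ T]
    rw [cfc_id' ℝ T]
    conv_lhs => enter [2]; rw [← cfc_id' ℝ T]
    rw [← cfc_mul (g k) (fun x => x) T (hg k).continuousOn]
  refine TraceBound.of_tendsto (T := fun k => cfc (g k) T * T) (fun k => ?_) ?_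
  · have h1 : ‖cfc (g k) T‖ ≤ 1 := by
      refine norm_cfc_le zero_le_one fun x _ => ?_
      rw [Real.norm_eq_abs, abs_of_nonneg (le_max_left _ _)]
      exact max_le zero_le_one (min_le_left _ _)
    refine (hT.mul_left _).mono ?_
    have := hT.nonneg
    nlinarith
  · rw [tendsto_iff_norm_sub_tendsto_zero]
    refine squeeze_zero (fun _ => norm_nonneg _) (fun k => ?_)
      (tendsto_one_div_add_atTop_nhds_zero_nat (𝕜 := ℝ))
    rw [hmul k, ← cfc_sub (fun x => g k x * x) (fun x => max x 0) T
      (by have := hg k; fun_prop) (by fun_prop)]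
    have hk : (0 : ℝ) < k + 1 := by positivity
    refine norm_cfc_le (by positivity) fun x _ => ?_
    rw [Real.norm_eq_abs]
    simp only [g]
    rcases le_or_gt x 0 with hx | hx
    · have : (k + 1 : ℝ) * x ≤ 0 := mul_nonpos_of_nonneg_of_nonpos hk.le hx
      rw [max_eq_right hx, min_eq_right (by linarith), max_eq_left this]
      simp
      positivity
    · have h0 : 0 < (k + 1 : ℝ) * x := mul_pos hk hx
      rw [max_eq_left hx.le, max_eq_right (le_min zero_le_one h0.le)]
      rcases le_total 1 ((k + 1 : ℝ) * x) with h1 | h1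
      · rw [min_eq_left h1]
        simp
        positivity
      · rw [min_eq_right h1, abs_le]
        have h2 : x ≤ 1 / (k + 1 : ℝ) := by
          rw [le_div_iff₀ hk]; linarith
        have h3 : (k + 1 : ℝ) * x * x ≤ 1 * x := mul_le_mul_of_nonneg_right h1 hx.le
        constructor <;> nlinarith [mul_pos h0 hx]

/-- The coordinate projection onto the span of `b i`, `i ∈ F`. -/
def basisProj (b : HilbertBasis ℕ ℂ H) (F : Finset ℕ) : H →L[ℂ] H :=
  ∑ i ∈ F, (innerSL ℂ (b i : H)).smulRight (b i : H)

theorem basisProj_apply (b : HilbertBasis ℕ ℂ H) (F : Finset ℕ) (x : H) :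
    basisProj b F x = ∑ i ∈ F, ⟪(b i : H), x⟫_ℂ • (b i : H) := by
  simp [basisProj]

theorem tendsto_basisProj (b : HilbertBasis ℕ ℂ H) (x : H) :
    Tendsto (fun F => basisProj b F x) atTop (nhds x) := by
  have h : Tendsto (fun F : Finset ℕ => ∑ i ∈ F, b.repr x i • (b i : H)) atTop (nhds x) :=
    b.hasSum_repr x
  refine h.congr fun F => ?_
  rw [basisProj_apply]
  exact Finset.sum_congr rfl fun i _ => by rw [b.repr_apply_apply]

theorem norm_sub_basisProj_le (b : HilbertBasis ℕ ℂ H) (F : Finset ℕ) (x : H) :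
    ‖x - basisProj b F x‖ ≤ ‖x‖ := by
  have h1 : ∀ i ∈ F, ⟪(b i : H), x - basisProj b F x⟫_ℂ = 0 := fun i hi => by
    rw [inner_sub_right, basisProj_apply, b.orthonormal.inner_right_sum _ hi, sub_self]
  have h2 : ⟪basisProj b F x, x - basisProj b F x⟫_ℂ = 0 := by
    have h : ⟪basisProj b F x, x - basisProj b F x⟫_ℂ =
        ⟪∑ i ∈ F, ⟪(b i : H), x⟫_ℂ • (b i : H), x - basisProj b F x⟫_ℂ := by
      rw [← basisProj_apply]
    rw [h, sum_inner]
    exact Finset.sum_eq_zero fun i hi => by rw [inner_smul_left, h1 i hi, mul_zero]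
  have h3 := norm_add_sq_eq_norm_sq_add_norm_sq_of_inner_eq_zero _ _ h2
  rw [add_sub_cancel] at h3
  nlinarith [norm_nonneg x, norm_nonneg (x - basisProj b F x),
    mul_self_nonneg ‖basisProj b F x‖]

theorem HilbertBasis.hasSum_norm_inner_sq (b : HilbertBasis ℕ ℂ H) (x : H) :
    HasSum (fun n => ‖⟪(b n : H), x⟫_ℂ‖ ^ 2) (‖x‖ ^ 2) := by
  have h := b.hasSum_inner_mul_inner x x
  rw [inner_self_eq_norm_sq_to_K] at h
  have h' := (Complex.hasSum_re h)
  convert h' using 1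
  · funext n
    rw [← inner_conj_symm x (b n : H), ← Complex.normSq_eq_conj_mul_self, Complex.ofReal_re,
      Complex.normSq_eq_norm_sq]
  · simp [← Complex.ofReal_pow]

theorem sum_norm_star_apply_sq_le (b : HilbertBasis ℕ ℂ H) {X : H →L[ℂ] H}
    (hX : Summable fun n => ‖X (b n)‖ ^ 2) {n : ℕ} {e : Fin n → H} (he : Orthonormal ℂ e) :
    ∑ i, ‖star X (e i)‖ ^ 2 ≤ ∑' k, ‖X (b k)‖ ^ 2 := by
  have h : HasSum (fun k => ∑ i, ‖⟪(b k : H), star X (e i)⟫_ℂ‖ ^ 2) (∑ i, ‖star X (e i)‖ ^ 2) :=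
    hasSum_sum fun i _ => HilbertBasis.hasSum_norm_inner_sq b (star X (e i))
  refine hasSum_le (fun k => ?_) h hX.hasSum
  refine le_trans (le_of_eq ?_) (he.sum_inner_products_le (X (b k)) (s := Finset.univ))
  refine Finset.sum_congr rfl fun i _ => ?_
  rw [ContinuousLinearMap.star_eq_adjoint, ContinuousLinearMap.adjoint_inner_right,
    ← inner_conj_symm, RCLike.norm_conj]

theorem TraceBound.mul_of_sq_sum_le {X Y : H →L[ℂ] H} {α β : ℝ} (hα : 0 ≤ α) (hβ : 0 ≤ β)
    (hX : ∀ (n : ℕ) (e : Fin n → H), Orthonormal ℂ e → ∑ i, ‖star X (e i)‖ ^ 2 ≤ α ^ 2)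
    (hY : ∀ (n : ℕ) (e : Fin n → H), Orthonormal ℂ e → ∑ i, ‖Y (e i)‖ ^ 2 ≤ β ^ 2) :
    TraceBound (X * Y) (α * β) := fun n e f he hf => by
  have h1 : ∀ i, ‖⟪e i, (X * Y) (f i)⟫_ℂ‖ ≤ ‖star X (e i)‖ * ‖Y (f i)‖ := fun i => by
    rw [mul_apply_eq_comp, ← ContinuousLinearMap.adjoint_inner_left,
      ← ContinuousLinearMap.star_eq_adjoint]
    exact norm_inner_le_norm _ _
  refine (Finset.sum_le_sum fun i _ => h1 i).trans ?_
  refine abs_le_of_sq_le_sq' ?_ (mul_nonneg hα hβ) |>.2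
  refine (Finset.sum_mul_sq_le_sq_mul_sq _ _ _).trans ?_
  rw [mul_pow]
  exact mul_le_mul (hX n e he) (hY n f hf) (Finset.sum_nonneg fun _ _ => sq_nonneg _)
    (sq_nonneg _)

/-- `T` is approximated from the left, in trace norm, by its coordinate truncations. -/
def TailVanishes (b : HilbertBasis ℕ ℂ H) (T : H →L[ℂ] H) : Prop :=
  ∀ ε : ℝ, 0 < ε → ∀ᶠ F in atTop, TraceBound ((1 - basisProj b F) * T) ε

theorem TailVanishes.add {b : HilbertBasis ℕ ℂ H} {S T : H →L[ℂ] H} (hS : TailVanishes b S)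
    (hT : TailVanishes b T) : TailVanishes b (S + T) := fun ε hε => by
  filter_upwards [hS (ε / 2) (half_pos hε), hT (ε / 2) (half_pos hε)] with F h1 h2
  rw [mul_add]
  exact (h1.add h2).mono (add_halves ε).le

theorem TailVanishes.mul_right {b : HilbertBasis ℕ ℂ H} {T : H →L[ℂ] H}
    (hT : TailVanishes b T) (X : H →L[ℂ] H) : TailVanishes b (T * X) := fun ε hε => by
  have hp : (0 : ℝ) < 2 * ‖X‖ + 1 := by positivity
  filter_upwards [hT (ε / (2 * ‖X‖ + 1)) (by positivity)] with F h
  rw [← mul_assoc]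
  refine (h.mul_right X).mono ?_
  rw [mul_div_assoc', div_le_iff₀ hp]
  nlinarith

theorem TailVanishes.mul_self {b : HilbertBasis ℕ ℂ H} {Q : H →L[ℂ] H} {C : ℝ}
    (hQ : IsSelfAdjoint Q) (hT : TraceBound (Q * Q) C) : TailVanishes b (Q * Q) := by
  have hC := hT.nonneg
  have hnorm : ∀ x, ‖Q x‖ ^ 2 = ‖⟪x, (Q * Q) x⟫_ℂ‖ := fun x => by
    rw [mul_apply_eq_comp, ← ContinuousLinearMap.adjoint_inner_left,
      ← ContinuousLinearMap.star_eq_adjoint, hQ.star_eq, inner_self_eq_norm_sq_to_K]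
    simp
  have hY : ∀ (n : ℕ) (e : Fin n → H), Orthonormal ℂ e →
      ∑ i, ‖Q (e i)‖ ^ 2 ≤ (Real.sqrt C) ^ 2 := fun n e he => by
    rw [Real.sq_sqrt hC, Finset.sum_congr rfl fun i _ => hnorm (e i)]
    exact hT n e e he he
  have hsum : Summable fun n => ‖Q (b n)‖ ^ 2 := by
    refine summable_of_sum_le (c := C) (fun _ => sq_nonneg _) fun u => ?_
    rw [← Finset.sum_coe_sort]
    simp only [hnorm]
    have ho := b.orthonormal.comp (fun i : u => (i : ℕ)) Subtype.val_injective
    exact hT.fintype ho ho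
  have hb : ∀ F x, ‖((1 - basisProj b F) * Q) x‖ ≤ ‖Q x‖ := fun F x => by
    simpa using norm_sub_basisProj_le b F (Q x)
  have hbs : ∀ F n, ‖((1 - basisProj b F) * Q) (b n)‖ ^ 2 ≤ ‖Q (b n)‖ ^ 2 := fun F n =>
    pow_le_pow_left₀ (norm_nonneg _) (hb F _) 2
  have ht : Tendsto (fun F => ∑' n, ‖((1 - basisProj b F) * Q) (b n)‖ ^ 2) atTop (nhds 0) := by
    have := tendsto_tsum_of_dominated_convergence (𝓕 := atTop) (g := fun _ : ℕ => (0 : ℝ))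
      (f := fun (F : Finset ℕ) n => ‖((1 - basisProj b F) * Q) (b n)‖ ^ 2) hsum (fun n => ?_)
      (Eventually.of_forall fun F n => ?_)
    · simpa using this
    · have h := (tendsto_basisProj b (Q (b n))).const_sub (Q (b n))
      simpa using (h.norm.pow 2)
    · rw [Real.norm_eq_abs, abs_of_nonneg (sq_nonneg _)]
      exact hbs F n
  intro ε hε
  have hp : 0 < Real.sqrt C + 1 := by positivity
  have hδ : 0 < ε / (Real.sqrt C + 1) := by positivity
  filter_upwards [ht.eventually (gt_mem_nhds (pow_pos hδ 2))] with F hF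
  rw [← mul_assoc]
  refine (TraceBound.mul_of_sq_sum_le hδ.le (Real.sqrt_nonneg C) (fun n e he => ?_) hY).mono ?_
  · refine (sum_norm_star_apply_sq_le b (Summable.of_nonneg_of_le (fun _ => sq_nonneg _)
      (hbs F) hsum) he).trans hF.le
  · rw [div_mul_eq_mul_div, div_le_iff₀ hp]
    nlinarith [Real.sqrt_nonneg C]

theorem TailVanishes.of_isSelfAdjoint {b : HilbertBasis ℕ ℂ H} {T : H →L[ℂ] H} {C : ℝ}
    (hs : IsSelfAdjoint T) (hT : TraceBound T C) : TailVanishes b T := by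
  have key : ∀ {S : H →L[ℂ] H}, IsSelfAdjoint S → TraceBound S C →
      TailVanishes b (cfc (fun x : ℝ => max x 0) S) := fun {S} hS hC => by
    have hsq : cfc (fun x : ℝ => max x 0) S =
        cfc (fun x : ℝ => Real.sqrt (max x 0)) S * cfc (fun x : ℝ => Real.sqrt (max x 0)) S := by
      rw [← cfc_mul _ _ S (by fun_prop) (by fun_prop)]
      exact cfc_congr fun x _ => (Real.mul_self_sqrt (le_max_right x 0)).symm
    have h := hC.cfc_max_zero hS
    rw [hsq] at h ⊢
    exact TailVanishes.mul_self (cfc_predicate _ S) h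
  have hd : T = cfc (fun x : ℝ => max x 0) T + cfc (fun x : ℝ => max x 0) (-T) * (-1) := by
    have h2 : cfc (fun x : ℝ => max x 0) (-T) = cfc (fun x : ℝ => max (-x) 0) T := by
      rw [cfc_comp_neg (fun x : ℝ => max x 0) T (by fun_prop) hs]
    rw [h2, mul_neg, mul_one, ← sub_eq_add_neg, ← cfc_sub _ _ T (by fun_prop) (by fun_prop)]
    conv_lhs => rw [← cfc_id' ℝ T]
    refine cfc_congr fun x _ => ?_
    rcases le_total x 0 with hx | hx
    · simp [hx]
    · simp [hx]
  rw [hd]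
  exact (key hs hT).add ((key hs.neg hT.neg).mul_right _)

theorem TraceBound.tailVanishes {T : H →L[ℂ] H} {C : ℝ} (hT : TraceBound T C)
    (b : HilbertBasis ℕ ℂ H) : TailVanishes b T := by
  have hd : T = (1 / 2 : ℂ) • (T + star T) +
      ((1 / 2 : ℂ) • (Complex.I • (T - star T))) * ((-Complex.I) • 1) := by
    rw [mul_smul_comm, mul_one, smul_smul, smul_smul]
    have : -Complex.I * (1 / 2) * Complex.I = 1 / 2 := by
      linear_combination (-1 / 2 : ℂ) * Complex.I_mul_I
    rw [this, ← smul_add]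
    have : T + star T + (T - star T) = (2 : ℂ) • T := by rw [two_smul]; abel
    rw [this, smul_smul]
    norm_num
  have h1 : IsSelfAdjoint ((1 / 2 : ℂ) • (T + star T)) := by
    rw [IsSelfAdjoint, star_smul, star_add, star_star, add_comm (star T)]
    simp
  have h2 : IsSelfAdjoint ((1 / 2 : ℂ) • (Complex.I • (T - star T))) := by
    rw [IsSelfAdjoint, star_smul, star_smul, star_sub, star_star, ← neg_sub T (star T)]
    simp [← smul_neg]
  rw [hd]
  exact (TailVanishes.of_isSelfAdjoint h1 ((hT.add hT.adjoint).smul _)).add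
    ((TailVanishes.of_isSelfAdjoint h2 (((hT.sub hT.adjoint).smul _).smul _)).mul_right _)

/-! ### Finite sections and the Fredholm determinant -/

open scoped ComplexOrder in
theorem Matrix.norm_det_one_add_sq_le {n : Type*} [Fintype n] [DecidableEq n] (M : Matrix n n ℂ) :
    ‖(1 + M).det‖ ^ 2 ≤ Real.exp (2 * M.trace.re + ∑ j, ∑ i, ‖M i j‖ ^ 2) := by
  have hP : (Matrix.conjTranspose (1 + M) * (1 + M)).PosSemidef :=
    Matrix.posSemidef_conjTranspose_mul_self _
  have hdet : (Matrix.conjTranspose (1 + M) * (1 + M)).det = ((‖(1 + M).det‖ ^ 2 : ℝ) : ℂ) := by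
    rw [Matrix.det_mul, Matrix.det_conjTranspose, ← starRingEnd_apply, Complex.conj_mul']
    push_cast
    rfl
  have htr : (Matrix.conjTranspose (1 + M) * (1 + M)).trace =
      ((Fintype.card n + (2 * M.trace.re + ∑ j, ∑ i, ‖M i j‖ ^ 2) : ℝ) : ℂ) := by
    have h1 : Matrix.conjTranspose (1 + M) * (1 + M) =
        1 + (M + Matrix.conjTranspose M) + Matrix.conjTranspose M * M := by
      rw [Matrix.conjTranspose_add, Matrix.conjTranspose_one]
      noncomm_ring
    rw [h1, Matrix.trace_add, Matrix.trace_add, Matrix.trace_add, Matrix.trace_one,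
      Matrix.trace_conjTranspose, ← starRingEnd_apply, Complex.add_conj, add_assoc]
    have h2 : (Matrix.conjTranspose M * M).trace = ((∑ j, ∑ i, ‖M i j‖ ^ 2 : ℝ) : ℂ) := by
      simp only [Matrix.trace, Matrix.diag_apply, Matrix.mul_apply, Matrix.conjTranspose_apply]
      push_cast
      refine Finset.sum_congr rfl fun j _ => Finset.sum_congr rfl fun i _ => ?_
      rw [← starRingEnd_apply, Complex.conj_mul']
    rw [h2]
    push_cast
    ring
  rw [hP.isHermitian.det_eq_prod_eigenvalues] at hdet
  rw [hP.isHermitian.trace_eq_sum_eigenvalues] at htr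
  have hd : ∏ i, hP.isHermitian.eigenvalues i = ‖(1 + M).det‖ ^ 2 := by
    apply Complex.ofReal_injective
    rw [← hdet]
    simp
  have ht : ∑ i, hP.isHermitian.eigenvalues i =
      Fintype.card n + (2 * M.trace.re + ∑ j, ∑ i, ‖M i j‖ ^ 2) := by
    apply Complex.ofReal_injective
    rw [← htr]
    simp
  rw [← hd]
  calc ∏ i, hP.isHermitian.eigenvalues i
      ≤ ∏ i, Real.exp (hP.isHermitian.eigenvalues i - 1) :=
        Finset.prod_le_prod (fun i _ => hP.eigenvalues_nonneg i) fun i _ => by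
          linarith [Real.add_one_le_exp (hP.isHermitian.eigenvalues i - 1)]
    _ = Real.exp (2 * M.trace.re + ∑ j, ∑ i, ‖M i j‖ ^ 2) := by
        rw [← Real.exp_sum, Finset.sum_sub_distrib, ht]
        simp

/-- The matrix of `T` with rows indexed by `F` and columns indexed by `G`. -/
def sectionMatrix (b : HilbertBasis ℕ ℂ H) (F G : Finset ℕ) (T : H →L[ℂ] H) : Matrix F G ℂ :=
  Matrix.of fun i j => ⟪(b (i : ℕ) : H), T (b (j : ℕ))⟫_ℂ

/-- The determinant of the finite section of `1 + T` along `F`. -/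
def sectionDet (b : HilbertBasis ℕ ℂ H) (F : Finset ℕ) (T : H →L[ℂ] H) : ℂ :=
  (1 + sectionMatrix b F F T).det

theorem detI_eq_limUnder (b : HilbertBasis ℕ ℂ H) (T : H →L[ℂ] H) :
    detI b T = limUnder atTop fun F => sectionDet b F T := by
  unfold detI sectionDet
  congr 1
  funext F
  congr 1
  ext i j
  rw [Matrix.add_apply, Matrix.one_apply]
  by_cases h : i = j
  · rw [if_pos h, Matrix.of_apply, if_pos (congrArg _ h)]
    rfl
  · rw [if_neg h, Matrix.of_apply, if_neg fun h' => h (Subtype.ext h')]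
    rfl

section sectionMatrix

variable (b : HilbertBasis ℕ ℂ H)

theorem sectionMatrix_add (F G : Finset ℕ) (S T : H →L[ℂ] H) :
    sectionMatrix b F G (S + T) = sectionMatrix b F G S + sectionMatrix b F G T := by
  ext i j
  simp [sectionMatrix]

theorem sectionMatrix_smul (F G : Finset ℕ) (c : ℂ) (T : H →L[ℂ] H) :
    sectionMatrix b F G (c • T) = c • sectionMatrix b F G T := by
  ext i j
  simp [sectionMatrix]

theorem sectionMatrix_mul (F G K : Finset ℕ) (S T : H →L[ℂ] H) :
    sectionMatrix b F G S * sectionMatrix b G K T =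
      sectionMatrix b F K (S * basisProj b G * T) := by
  ext i j
  simp only [sectionMatrix, Matrix.mul_apply, Matrix.of_apply, mul_apply_eq_comp,
    basisProj_apply, map_sum, map_smul, inner_sum, inner_smul_right]
  rw [← Finset.sum_coe_sort G]
  exact Finset.sum_congr rfl fun _ _ => mul_comm _ _

theorem trace_sectionMatrix (F : Finset ℕ) (T : H →L[ℂ] H) :
    (sectionMatrix b F F T).trace = ∑ i ∈ F, ⟪(b i : H), T (b i)⟫_ℂ := by
  rw [← Finset.sum_coe_sort F]
  rfl

theorem sectionDet_add_mul (F : Finset ℕ) (S T : H →L[ℂ] H) :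
    sectionDet b F S * sectionDet b F T =
      sectionDet b F (S + T + S * basisProj b F * T) := by
  rw [sectionDet, sectionDet, sectionDet, ← Matrix.det_mul, sectionMatrix_add,
    sectionMatrix_add, ← sectionMatrix_mul]
  congr 1
  noncomm_ring

theorem sectionDet_mul_comm (F G : Finset ℕ) (S T : H →L[ℂ] H) :
    sectionDet b F (S * basisProj b G * T) = sectionDet b G (T * basisProj b F * S) := by
  rw [sectionDet, sectionDet, ← sectionMatrix_mul, ← sectionMatrix_mul,
    Matrix.det_one_add_mul_comm]

theorem trace_sectionMatrix_mul_comm (F : Finset ℕ) (S T : H →L[ℂ] H) :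
    (sectionMatrix b F F (S * basisProj b F * T)).trace =
      (sectionMatrix b F F (T * basisProj b F * S)).trace := by
  rw [← sectionMatrix_mul, ← sectionMatrix_mul, Matrix.trace_mul_comm]

theorem basisProj_apply_of_mem {F : Finset ℕ} {i : ℕ} (hi : i ∈ F) :
    basisProj b F (b i) = b i := by
  rw [basisProj_apply, Finset.sum_eq_single i]
  · rw [inner_self_eq_norm_sq_to_K, b.orthonormal.1 i]
    simp
  · intro j _ hj
    rw [b.orthonormal.2 hj, zero_smul]
  · exact fun h => absurd hi h

theorem sectionDet_basisProj_mul {F G : Finset ℕ} (h : F ⊆ G) (T : H →L[ℂ] H) :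
    sectionDet b G (basisProj b F * T) = sectionDet b F T := by
  have h1 := sectionDet_mul_comm b G F 1 T
  rw [one_mul, mul_one] at h1
  rw [h1, sectionDet, sectionDet]
  congr 2
  ext i j
  simp only [sectionMatrix, Matrix.of_apply, mul_apply_eq_comp]
  rw [basisProj_apply_of_mem b (h j.2)]

theorem star_basisProj (F : Finset ℕ) : star (basisProj b F) = basisProj b F := by
  rw [ContinuousLinearMap.star_eq_adjoint, eq_comm, ContinuousLinearMap.eq_adjoint_iff]
  intro x y
  simp only [basisProj_apply, sum_inner, inner_sum, inner_smul_left, inner_smul_right,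
    inner_conj_symm]
  exact Finset.sum_congr rfl fun _ _ => mul_comm _ _

variable {b}

theorem TraceBound.orthonormal_sum_le {T : H →L[ℂ] H} {C : ℝ} (hT : TraceBound T C)
    (F : Finset ℕ) : ∑ i ∈ F, ‖⟪(b i : H), T (b i)⟫_ℂ‖ ≤ C := by
  rw [← Finset.sum_coe_sort F]
  have ho := b.orthonormal.comp (fun i : F => (i : ℕ)) Subtype.val_injective
  exact hT.fintype ho ho

theorem TraceBound.norm_trace_sectionMatrix_le {T : H →L[ℂ] H} {C : ℝ} (hT : TraceBound T C)
    (F : Finset ℕ) : ‖(sectionMatrix b F F T).trace‖ ≤ C := by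
  rw [trace_sectionMatrix]
  exact (norm_sum_le _ _).trans (hT.orthonormal_sum_le F)

theorem TraceBound.sum_norm_sq_sectionMatrix_le {T : H →L[ℂ] H} {C : ℝ} (hT : TraceBound T C)
    (F : Finset ℕ) : ∑ j, ∑ i, ‖sectionMatrix b F F T i j‖ ^ 2 ≤ 2 * C ^ 2 := by
  have h1 : ∀ j : F, ∑ i, ‖sectionMatrix b F F T i j‖ ^ 2 ≤
      ‖⟪(b j : H), (star T * T) (b j)⟫_ℂ‖ := fun j => by
    have ho := b.orthonormal.comp (fun i : F => (i : ℕ)) Subtype.val_injective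
    refine (ho.sum_inner_products_le (T (b j)) (s := Finset.univ)).trans (le_of_eq ?_)
    rw [mul_apply_eq_comp, ContinuousLinearMap.star_eq_adjoint,
      ContinuousLinearMap.adjoint_inner_right, inner_self_eq_norm_sq_to_K]
    simp
  refine (Finset.sum_le_sum fun j _ => h1 j).trans ?_
  rw [Finset.sum_coe_sort F fun j => ‖⟪(b j : H), (star T * T) (b j)⟫_ℂ‖]
  refine ((hT.mul_left (star T)).orthonormal_sum_le F).trans ?_
  rw [norm_star]
  nlinarith [hT.norm_le, hT.nonneg]

theorem TraceBound.norm_sectionDet_le {T : H →L[ℂ] H} {C : ℝ} (hT : TraceBound T C)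
    (F : Finset ℕ) : ‖sectionDet b F T‖ ≤ Real.exp (C + C ^ 2) := by
  refine (sq_le_sq₀ (norm_nonneg _) (Real.exp_pos _).le).1 ?_
  rw [sectionDet]
  refine (Matrix.norm_det_one_add_sq_le (sectionMatrix b F F T)).trans ?_
  rw [← Real.exp_nat_mul, Real.exp_le_exp]
  have h1 := (Complex.re_le_norm _).trans (hT.norm_trace_sectionMatrix_le (b := b) F)
  have h2 := hT.sum_norm_sq_sectionMatrix_le (b := b) F
  push_cast
  linarith

theorem differentiable_sectionDet (F : Finset ℕ) (S T : H →L[ℂ] H) :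
    Differentiable ℂ fun c : ℂ => sectionDet b F (S + c • T) := by
  simp only [sectionDet, sectionMatrix_add, sectionMatrix_smul, Matrix.det_apply]
  simp only [Matrix.add_apply, Matrix.smul_apply]
  fun_prop

theorem TraceBound.norm_sectionDet_sub_le {T E : H →L[ℂ] H} {C δ : ℝ} (hT : TraceBound T C)
    (hE : TraceBound E δ) (hδ : 0 < δ) (hδ1 : δ < 1) (F : Finset ℕ) :
    ‖sectionDet b F (T + E) - sectionDet b F T‖ ≤
      2 * Real.exp ((C + 1) + (C + 1) ^ 2) * δ := by
  have hb : ∀ c ∈ Metric.ball (0 : ℂ) (1 / δ),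
      ‖sectionDet b F (T + c • E)‖ ≤ Real.exp ((C + 1) + (C + 1) ^ 2) := fun c hc => by
    refine TraceBound.norm_sectionDet_le ((hT.add (hE.smul c)).mono ?_) F
    rw [mem_ball_zero_iff, lt_div_iff₀ hδ] at hc
    linarith
  have h0 : (0 : ℂ) ∈ Metric.ball (0 : ℂ) (1 / δ) := by simpa using hδ
  have h1 : (1 : ℂ) ∈ Metric.ball (0 : ℂ) (1 / δ) := by
    rw [mem_ball_zero_iff, norm_one, lt_div_iff₀ hδ]
    linarith
  have h := Complex.dist_le_div_mul_dist_of_mapsTo_ball (c := (0 : ℂ)) (R₁ := 1 / δ)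
    (R₂ := 2 * Real.exp ((C + 1) + (C + 1) ^ 2))
    (differentiable_sectionDet (b := b) F T E).differentiableOn (fun c hc => ?_) h1
  · simp only [one_smul, zero_smul, add_zero, sub_zero, norm_one, mul_one,
      dist_eq_norm] at h
    rwa [div_div_eq_mul_div, div_one] at h
  · rw [Metric.mem_closedBall, dist_eq_norm]
    refine (norm_sub_le _ _).trans ?_
    linarith [hb c hc, hb 0 h0]

theorem TraceBound.tendsto_sectionDet_sub {T : H →L[ℂ] H} {C : ℝ} (hT : TraceBound T C)
    {E : Finset ℕ → H →L[ℂ] H}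
    (hE : ∀ ε : ℝ, 0 < ε → ∀ᶠ F in atTop, TraceBound (E F) ε) :
    Tendsto (fun F => sectionDet b F (T + E F) - sectionDet b F T) atTop (nhds 0) := by
  rw [Metric.tendsto_nhds]
  intro ε hε
  set K := 2 * Real.exp ((C + 1) + (C + 1) ^ 2) with hK
  have hKp : 0 < K := by positivity
  have hδ : 0 < min (1 / 2) (ε / (2 * K)) := by positivity
  filter_upwards [hE _ hδ] with F hF
  rw [dist_zero_right]
  refine (hT.norm_sectionDet_sub_le hF hδ
    ((min_le_left _ _).trans_lt (by norm_num)) F).trans_lt ?_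
  rw [← hK]
  calc K * min (1 / 2) (ε / (2 * K)) ≤ K * (ε / (2 * K)) :=
        mul_le_mul_of_nonneg_left (min_le_right _ _) hKp.le
    _ = ε / 2 := by field_simp
    _ < ε := half_lt_self hε

theorem TraceBound.eventually_mul_left {T : H →L[ℂ] H} {C : ℝ} (hT : TraceBound T C)
    (b : HilbertBasis ℕ ℂ H) (X : H →L[ℂ] H) {ε : ℝ} (hε : 0 < ε) :
    ∀ᶠ F in atTop, TraceBound (X * (1 - basisProj b F) * T) ε := by
  have hp : (0 : ℝ) < 2 * ‖X‖ + 1 := by positivity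
  filter_upwards [hT.tailVanishes b (ε / (2 * ‖X‖ + 1)) (by positivity)] with F h
  rw [mul_assoc]
  refine (h.mul_left X).mono ?_
  rw [mul_div_assoc', div_le_iff₀ hp]
  nlinarith

theorem TraceBound.eventually_mul_right {T : H →L[ℂ] H} {C : ℝ} (hT : TraceBound T C)
    (b : HilbertBasis ℕ ℂ H) (X : H →L[ℂ] H) {ε : ℝ} (hε : 0 < ε) :
    ∀ᶠ F in atTop, TraceBound (T * (1 - basisProj b F) * X) ε := by
  filter_upwards [hT.adjoint.eventually_mul_left b (star X) hε] with F h
  have := h.adjoint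
  simpa [star_basisProj, mul_assoc] using this

theorem TraceBound.tendsto_sectionDet {T : H →L[ℂ] H} {C : ℝ} (hT : TraceBound T C)
    (b : HilbertBasis ℕ ℂ H) :
    Tendsto (fun F => sectionDet b F T) atTop (nhds (detI b T)) := by
  have hc : CauchySeq fun F => sectionDet b F T := by
    rw [Metric.cauchySeq_iff']
    intro ε hε
    set K := 2 * Real.exp ((C + 1) + (C + 1) ^ 2) with hK
    have hKp : 0 < K := by positivity
    have hδ : 0 < min (1 / 2) (ε / (2 * K)) := by positivity
    obtain ⟨F, hF⟩ := (hT.tailVanishes b _ hδ).exists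
    refine ⟨F, fun G hG => ?_⟩
    have h := hT.norm_sectionDet_sub_le (b := b) hF.neg hδ
      ((min_le_left _ _).trans_lt (by norm_num)) G
    have e : T + -((1 - basisProj b F) * T) = basisProj b F * T := by noncomm_ring
    rw [e, sectionDet_basisProj_mul b hG, ← hK] at h
    rw [dist_comm, dist_eq_norm]
    refine h.trans_lt ?_
    calc K * min (1 / 2) (ε / (2 * K)) ≤ K * (ε / (2 * K)) :=
          mul_le_mul_of_nonneg_left (min_le_right _ _) hKp.le
      _ = ε / 2 := by field_simp
      _ < ε := half_lt_self hε
  obtain ⟨d, hd⟩ := cauchySeq_tendsto_of_complete hc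
  rw [detI_eq_limUnder, hd.limUnder_eq]
  exact hd

/-- Multiplicativity of the Fredholm determinant. -/
theorem TraceBound.detI_mul {S T : H →L[ℂ] H} {C C' : ℝ} (hS : TraceBound S C)
    (hT : TraceBound T C') (b : HilbertBasis ℕ ℂ H) :
    detI b (S + T + S * T) = detI b S * detI b T := by
  have hST := (hS.add hT).add (hT.mul_left S)
  have h1 := hST.tendsto_sectionDet_sub (b := b) (E := fun F => -(S * (1 - basisProj b F) * T))
    fun ε hε => (hT.eventually_mul_left b S hε).mono fun F h => h.neg
  have h2 := h1.add (hST.tendsto_sectionDet b)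
  rw [zero_add] at h2
  refine tendsto_nhds_unique (h2.congr fun F => ?_)
    ((hS.tendsto_sectionDet b).mul (hT.tendsto_sectionDet b))
  rw [sectionDet_add_mul, sub_add_cancel]
  congr 1
  noncomm_ring

theorem TraceBound.detI_mul_comm {T : H →L[ℂ] H} {C : ℝ} (hT : TraceBound T C)
    (X : H →L[ℂ] H) (b : HilbertBasis ℕ ℂ H) : detI b (X * T) = detI b (T * X) := by
  have hl := hT.mul_left X
  have hr := hT.mul_right X
  have h1 := (hl.tendsto_sectionDet_sub (b := b)
    (E := fun F => -(X * (1 - basisProj b F) * T))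
    fun ε hε => (hT.eventually_mul_left b X hε).mono fun F h => h.neg).add
    (hl.tendsto_sectionDet b)
  have h2 := (hr.tendsto_sectionDet_sub (b := b)
    (E := fun F => -(T * (1 - basisProj b F) * X))
    fun ε hε => (hT.eventually_mul_right b X hε).mono fun F h => h.neg).add
    (hr.tendsto_sectionDet b)
  rw [zero_add] at h1 h2
  refine tendsto_nhds_unique h1 (h2.congr fun F => ?_)
  have e1 : X * T + -(X * (1 - basisProj b F) * T) = X * basisProj b F * T := by noncomm_ring
  have e2 : T * X + -(T * (1 - basisProj b F) * X) = T * basisProj b F * X := by noncomm_ring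
  rw [sub_add_cancel, sub_add_cancel, e1, e2, sectionDet_mul_comm]

theorem TraceBound.hasSum_traceH {T : H →L[ℂ] H} {C : ℝ} (hT : TraceBound T C)
    (b : HilbertBasis ℕ ℂ H) : HasSum (fun n => ⟪(b n : H), T (b n)⟫_ℂ) (traceH b T) := by
  have : Summable fun n => ‖⟪(b n : H), T (b n)⟫_ℂ‖ :=
    summable_of_sum_le (fun _ => norm_nonneg _) fun u => hT.orthonormal_sum_le u
  exact this.of_norm.hasSum

theorem TraceBound.tendsto_trace_sectionMatrix {T : H →L[ℂ] H} {C : ℝ} (hT : TraceBound T C)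
    (b : HilbertBasis ℕ ℂ H) :
    Tendsto (fun F => (sectionMatrix b F F T).trace) atTop (nhds (traceH b T)) := by
  simp only [trace_sectionMatrix]
  exact hT.hasSum_traceH b

theorem TraceBound.norm_traceH_le {T : H →L[ℂ] H} {C : ℝ} (hT : TraceBound T C)
    (b : HilbertBasis ℕ ℂ H) : ‖traceH b T‖ ≤ C :=
  le_of_tendsto (hT.tendsto_trace_sectionMatrix b).norm
    (Eventually.of_forall fun F => hT.norm_trace_sectionMatrix_le F)

theorem TraceBound.traceH_add {S T : H →L[ℂ] H} {C C' : ℝ} (hS : TraceBound S C)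
    (hT : TraceBound T C') (b : HilbertBasis ℕ ℂ H) :
    traceH b (S + T) = traceH b S + traceH b T := by
  refine ((hS.add hT).hasSum_traceH b).unique ?_
  simpa [inner_add_right] using (hS.hasSum_traceH b).add (hT.hasSum_traceH b)

theorem TraceBound.traceH_mul_comm {T : H →L[ℂ] H} {C : ℝ} (hT : TraceBound T C)
    (X : H →L[ℂ] H) (b : HilbertBasis ℕ ℂ H) : traceH b (X * T) = traceH b (T * X) := by
  have hz : ∀ {E : Finset ℕ → H →L[ℂ] H},
      (∀ ε : ℝ, 0 < ε → ∀ᶠ F in atTop, TraceBound (E F) ε) →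
      Tendsto (fun F => (sectionMatrix b F F (E F)).trace) atTop (nhds 0) := fun {E} hE => by
    rw [Metric.tendsto_nhds]
    intro ε hε
    filter_upwards [hE _ (half_pos hε)] with F hF
    rw [dist_zero_right]
    exact (hF.norm_trace_sectionMatrix_le F).trans_lt (half_lt_self hε)
  have h1 := ((hT.mul_left X).tendsto_trace_sectionMatrix b).sub
    (hz fun ε hε => hT.eventually_mul_left b X hε)
  have h2 := ((hT.mul_right X).tendsto_trace_sectionMatrix b).sub
    (hz fun ε hε => hT.eventually_mul_right b X hε)
  rw [sub_zero] at h1 h2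
  refine tendsto_nhds_unique h1 (h2.congr fun F => ?_)
  have e1 : X * T = X * basisProj b F * T + X * (1 - basisProj b F) * T := by noncomm_ring
  have e2 : T * X = T * basisProj b F * X + T * (1 - basisProj b F) * X := by noncomm_ring
  rw [e1, e2, sectionMatrix_add, sectionMatrix_add, Matrix.trace_add, Matrix.trace_add,
    trace_sectionMatrix_mul_comm]
  ring

theorem TraceBound.norm_detI_smul_sub_le {T : H →L[ℂ] H} {C : ℝ} (hT : TraceBound T C)
    (b : HilbertBasis ℕ ℂ H) {c : ℂ} (hc : ‖c‖ < 1) :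
    ‖detI b (c • T) - (1 + c * traceH b T)‖ ≤ (Real.exp (C + C ^ 2) + C + 1) * ‖c‖ ^ 2 := by
  have hfin : ∀ F, ‖sectionDet b F (c • T) - (1 + c * (sectionMatrix b F F T).trace)‖ ≤
      (Real.exp (C + C ^ 2) + C + 1) * ‖c‖ ^ 2 := fun F => by
    let g : ℂ → ℂ := fun w => sectionDet b F (0 + w • T) - w * (sectionMatrix b F F T).trace
    have hg : Differentiable ℂ g :=
      (differentiable_sectionDet F 0 T).sub (differentiable_id.mul_const _)
    have hg0 : g 0 = 1 := by
      simp only [g, zero_add, sectionDet, sectionMatrix_smul]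
      simp
    have hmaps : Set.MapsTo g (Metric.ball 0 1)
        (Metric.closedBall (g 0) (Real.exp (C + C ^ 2) + C + 1)) := fun w hw => by
      rw [mem_ball_zero_iff] at hw
      rw [Metric.mem_closedBall, dist_eq_norm, hg0]
      have h1 : ‖sectionDet b F (0 + w • T)‖ ≤ Real.exp (C + C ^ 2) := by
        rw [zero_add]
        refine TraceBound.norm_sectionDet_le ((hT.smul w).mono ?_) F
        nlinarith [hT.nonneg]
      have h2 : ‖w * (sectionMatrix b F F T).trace‖ ≤ C := by
        rw [norm_mul]
        nlinarith [hT.norm_trace_sectionMatrix_le (b := b) F, norm_nonneg w, hT.nonneg,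
          norm_nonneg (sectionMatrix b F F T).trace]
      refine (norm_sub_le _ _).trans (add_le_add ((norm_sub_le _ _).trans (add_le_add h1 h2)) ?_)
      simp
    have ho : (fun w => g w - g 0) =o[nhds 0] fun w => ‖w - 0‖ ^ 1 := by
      have he : ∀ w, g w - g 0 = (w * (1 + (Polynomial.X : Polynomial ℂ) •
          (sectionMatrix b F F T).map Polynomial.C).det.divX.divX.eval w) * w := fun w => by
        rw [hg0]
        simp only [g, zero_add, sectionDet, sectionMatrix_smul]
        rw [Matrix.det_one_add_smul]
        ring
      simp only [he, pow_one, sub_zero]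
      refine Asymptotics.IsLittleO.norm_right ?_
      refine Asymptotics.IsLittleO.mul_isBigO (f₁ := _) (g₁ := fun _ => (1 : ℂ))
        ?_ (Asymptotics.isBigO_refl (fun w : ℂ => w) _) |>.congr_right fun w => one_mul w
      rw [Asymptotics.isLittleO_one_iff]
      have hcont : Continuous fun w : ℂ => w * (1 + (Polynomial.X : Polynomial ℂ) •
          (sectionMatrix b F F T).map Polynomial.C).det.divX.divX.eval w := by fun_prop
      simpa using hcont.tendsto 0
    have h := Complex.dist_le_mul_div_pow_of_mapsTo_ball_of_isLittleO hg.differentiableOn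
      hmaps ho (mem_ball_zero_iff.2 hc)
    rw [hg0, dist_zero_right, div_one, dist_eq_norm] at h
    refine le_trans (le_of_eq ?_) h
    simp only [g, zero_add]
    congr 1
    ring
  exact le_of_tendsto ((((hT.smul c).tendsto_sectionDet b).sub
    (((hT.tendsto_trace_sectionMatrix b).const_mul c).const_add 1)).norm)
    (Eventually.of_forall hfin)

end sectionMatrix

/-! ### The Balakrishnan square root -/

theorem integrableOn_inv_sqrt_mul_inv_add {s : ℝ} (hs : 0 < s) :
    IntegrableOn (fun t : ℝ => (Real.sqrt t)⁻¹ * (s + t)⁻¹) (Set.Ioi 0) ∧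
      ∫ t in Set.Ioi (0 : ℝ), (Real.sqrt t)⁻¹ * (s + t)⁻¹ = Real.pi / Real.sqrt s := by
  have hs' : 0 < Real.sqrt s := Real.sqrt_pos.2 hs
  let g : ℝ → ℝ := fun t => 2 / Real.sqrt s * Real.arctan (Real.sqrt t / Real.sqrt s)
  have hg0 : g 0 = 0 := by simp [g]
  have hgc : Continuous g := by fun_prop
  have hd : ∀ x ∈ Set.Ioi (0 : ℝ), HasDerivAt g ((Real.sqrt x)⁻¹ * (s + x)⁻¹) x := fun x hx => by
    have hx' : 0 < Real.sqrt x := Real.sqrt_pos.2 hx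
    have h1 := (((Real.hasDerivAt_sqrt (ne_of_gt hx)).div_const (Real.sqrt s)).arctan).const_mul
      (2 / Real.sqrt s)
    refine h1.congr_deriv ?_
    rw [div_pow, Real.sq_sqrt hs.le, Real.sq_sqrt (le_of_lt hx)]
    have : 0 < s + x := add_pos hs hx
    field_simp
    rw [Real.sq_sqrt hs.le]
  have hp : ∀ x ∈ Set.Ioi (0 : ℝ), 0 ≤ (Real.sqrt x)⁻¹ * (s + x)⁻¹ := fun x hx => by
    have : 0 < s + x := add_pos hs hx
    positivity
  have hl : Tendsto g atTop (nhds (Real.pi / Real.sqrt s)) := by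
    have h1 : Tendsto (fun t : ℝ => Real.sqrt t / Real.sqrt s) atTop atTop :=
      Real.tendsto_sqrt_atTop.atTop_div_const hs'
    have h2 := ((Real.tendsto_arctan_atTop.mono_right nhdsWithin_le_nhds).comp h1).const_mul
      (2 / Real.sqrt s)
    refine h2.congr' ?_ |>.mono_right (le_of_eq ?_)
    · exact Eventually.of_forall fun _ => rfl
    · congr 1
      field_simp
  refine ⟨integrableOn_Ioi_deriv_of_nonneg hgc.continuousWithinAt hd hp hl, ?_⟩
  rw [integral_Ioi_of_hasDerivAt_of_nonneg hgc.continuousWithinAt hd hp hl, hg0, sub_zero]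

theorem hasDerivWithinAt_of_norm_sub_le_sq {𝕜 E : Type*} [NontriviallyNormedField 𝕜]
    [NormedAddCommGroup E] [NormedSpace 𝕜 E] {f : 𝕜 → E} {f' : E} {S : Set 𝕜} {x : 𝕜} {C : ℝ}
    (h : ∀ᶠ y in nhdsWithin x S, ‖f y - f x - (y - x) • f'‖ ≤ C * ‖y - x‖ ^ 2) :
    HasDerivWithinAt f f' S x := by
  rw [hasDerivWithinAt_iff_isLittleO]
  have h1 : (fun y => f y - f x - (y - x) • f') =O[nhdsWithin x S] fun y => (y - x) ^ 2 := by
    refine Asymptotics.IsBigO.of_bound C ?_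
    filter_upwards [h] with y hy
    rwa [norm_pow]
  refine h1.trans_isLittleO ?_
  have h2 : (fun y : 𝕜 => (y - x) * (y - x)) =o[nhdsWithin x S] fun y => (1 : 𝕜) * (y - x) := by
    refine Asymptotics.IsLittleO.mul_isBigO ?_ (Asymptotics.isBigO_refl _ _)
    rw [Asymptotics.isLittleO_one_iff]
    have : Continuous fun y : 𝕜 => y - x := by fun_prop
    simpa using (this.tendsto x).mono_left nhdsWithin_le_nhds
  simpa [pow_two] using h2

section ResolventFamily

variable {E : Type*} [NormedRing E] [NormedAlgebra ℝ E] [CompleteSpace E]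

/-- A family satisfying the resolvent identity `ρ s - ρ t = (t - s) ρ s ρ t` on `[0, ∞)`,
with the decay `(1 + t)‖ρ t‖ ≤ M`. -/
structure IsResolventFamily (ρ : ℝ → E) (M : ℝ) : Prop where
  identity : ∀ s t, 0 ≤ s → 0 ≤ t → ρ s - ρ t = (t - s) • (ρ s * ρ t)
  bound : ∀ t, 0 ≤ t → (1 + t) * ‖ρ t‖ ≤ M

/-- The integral `∫₀^∞ t^{-1/2} ρ(s + t) dt`. -/
def sqrtIntegral (ρ : ℝ → E) (s : ℝ) : E :=
  ∫ t in Set.Ioi (0 : ℝ), (Real.sqrt t)⁻¹ • ρ (s + t)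

theorem integrableOn_inv_sqrt_smul {F : Type*} [NormedAddCommGroup F] [NormedSpace ℝ F]
    {f : ℝ → F} {C : ℝ} (hf : ContinuousOn f (Set.Ici 0))
    (hC : ∀ t, 0 < t → ‖f t‖ ≤ C * (1 + t)⁻¹) :
    IntegrableOn (fun t : ℝ => (Real.sqrt t)⁻¹ • f t) (Set.Ioi 0) := by
  refine Integrable.mono' (((integrableOn_inv_sqrt_mul_inv_add one_pos).1).const_mul C) ?_ ?_
  · refine ContinuousOn.aestronglyMeasurable ?_ measurableSet_Ioi
    refine ContinuousOn.smul (ContinuousOn.inv₀ (by fun_prop) fun t ht => ?_)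
      (hf.mono Set.Ioi_subset_Ici_self)
    exact (Real.sqrt_pos.2 ht).ne'
  · filter_upwards [ae_restrict_mem measurableSet_Ioi] with t ht
    rw [norm_smul, Real.norm_of_nonneg (by positivity)]
    calc (Real.sqrt t)⁻¹ * ‖f t‖ ≤ (Real.sqrt t)⁻¹ * (C * (1 + t)⁻¹) :=
          mul_le_mul_of_nonneg_left (hC t ht) (by positivity)
      _ = C * ((Real.sqrt t)⁻¹ * (1 + t)⁻¹) := by ring

theorem norm_integral_inv_sqrt_smul_le {F : Type*} [NormedAddCommGroup F] [NormedSpace ℝ F]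
    {f : ℝ → F} {C s : ℝ} (hs : 0 < s) (hC : ∀ t, 0 < t → ‖f t‖ ≤ C * (s + t)⁻¹) :
    ‖∫ t in Set.Ioi (0 : ℝ), (Real.sqrt t)⁻¹ • f t‖ ≤ C * (Real.pi / Real.sqrt s) := by
  rw [← (integrableOn_inv_sqrt_mul_inv_add hs).2, ← integral_const_mul]
  refine norm_integral_le_of_norm_le ((integrableOn_inv_sqrt_mul_inv_add hs).1.const_mul C) ?_
  filter_upwards [ae_restrict_mem measurableSet_Ioi] with t ht
  rw [norm_smul, Real.norm_of_nonneg (by positivity)]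
  calc (Real.sqrt t)⁻¹ * ‖f t‖ ≤ (Real.sqrt t)⁻¹ * (C * (s + t)⁻¹) :=
        mul_le_mul_of_nonneg_left (hC t ht) (by positivity)
    _ = C * ((Real.sqrt t)⁻¹ * (s + t)⁻¹) := by ring

namespace IsResolventFamily

variable {ρ : ℝ → E} {M : ℝ}

theorem nonneg (h : IsResolventFamily ρ M) : 0 ≤ M :=
  le_trans (by simp) (h.bound 0 le_rfl)

theorem norm_le_mul_inv (h : IsResolventFamily ρ M) {t : ℝ} (ht : 0 ≤ t) :
    ‖ρ t‖ ≤ M * (1 + t)⁻¹ := by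
  rw [← div_eq_mul_inv, le_div_iff₀ (by positivity), mul_comm]
  exact h.bound t ht

theorem norm_le (h : IsResolventFamily ρ M) {t : ℝ} (ht : 0 ≤ t) : ‖ρ t‖ ≤ M := by
  have := h.bound t ht
  nlinarith [norm_nonneg (ρ t)]

theorem commute (h : IsResolventFamily ρ M) {s t : ℝ} (hs : 0 ≤ s) (ht : 0 ≤ t) :
    ρ s * ρ t = ρ t * ρ s := by
  rcases eq_or_ne s t with rfl | hst
  · rfl
  have h1 := h.identity s t hs ht
  have h2 := h.identity t s ht hs
  rw [← neg_sub, h1, ← neg_smul, neg_sub] at h2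
  exact smul_right_injective E (sub_ne_zero.2 hst) h2

theorem norm_sub_le (h : IsResolventFamily ρ M) {s t : ℝ} (hs : 0 ≤ s) (ht : 0 ≤ t) :
    ‖ρ s - ρ t‖ ≤ |s - t| * M ^ 2 := by
  rw [h.identity s t hs ht, norm_smul, Real.norm_eq_abs, abs_sub_comm]
  refine mul_le_mul_of_nonneg_left ?_ (abs_nonneg _)
  refine (norm_mul_le _ _).trans ?_
  rw [pow_two]
  exact mul_le_mul (h.norm_le hs) (h.norm_le ht) (norm_nonneg _) h.nonneg

theorem shift (h : IsResolventFamily ρ M) {s : ℝ} (hs : 0 ≤ s) :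
    IsResolventFamily (fun t => ρ (s + t)) M where
  identity a c ha hc := by
    have := h.identity (s + a) (s + c) (by positivity) (by positivity)
    rwa [add_sub_add_left_eq_sub] at this
  bound t ht := by
    refine le_trans ?_ (h.bound (s + t) (by positivity))
    exact mul_le_mul_of_nonneg_right (by linarith) (norm_nonneg _)

theorem hasDerivWithinAt (h : IsResolventFamily ρ M) {s : ℝ} (hs : 0 ≤ s) :
    HasDerivWithinAt ρ (-(ρ s * ρ s)) (Set.Ici 0) s := by
  refine hasDerivWithinAt_of_norm_sub_le_sq (C := M ^ 3) ?_
  filter_upwards [self_mem_nhdsWithin] with y hy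
  have e : ρ y - ρ s - (y - s) • (-(ρ s * ρ s)) = -((y - s) • ((ρ y - ρ s) * ρ s)) := by
    rw [sub_mul, smul_sub, h.identity y s hy hs, ← neg_sub y s, neg_smul, smul_neg]
    abel
  rw [e, norm_neg, norm_smul, Real.norm_eq_abs]
  calc |y - s| * ‖(ρ y - ρ s) * ρ s‖ ≤ |y - s| * (|y - s| * M ^ 2 * M) := by
        refine mul_le_mul_of_nonneg_left ((norm_mul_le _ _).trans ?_) (abs_nonneg _)
        exact mul_le_mul (h.norm_sub_le hy hs) (h.norm_le hs) (norm_nonneg _)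
          (mul_nonneg (abs_nonneg _) (sq_nonneg _))
    _ = M ^ 3 * |y - s| ^ 2 := by ring

theorem continuousOn (h : IsResolventFamily ρ M) : ContinuousOn ρ (Set.Ici 0) :=
  fun _ hs => (h.hasDerivWithinAt hs).continuousWithinAt

theorem integrableOn (h : IsResolventFamily ρ M) {s : ℝ} (hs : 0 ≤ s) :
    IntegrableOn (fun t : ℝ => (Real.sqrt t)⁻¹ • ρ (s + t)) (Set.Ioi 0) :=
  integrableOn_inv_sqrt_smul (h.shift hs).continuousOn
    fun _ ht => (h.shift hs).norm_le_mul_inv ht.le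

theorem integrableOn_mul (h : IsResolventFamily ρ M) {s r : ℝ} (hs : 0 ≤ s) (hr : 0 ≤ r) :
    IntegrableOn (fun t : ℝ => (Real.sqrt t)⁻¹ • (ρ (s + t) * ρ (r + t))) (Set.Ioi 0) := by
  refine integrableOn_inv_sqrt_smul (C := M * M)
    ((h.shift hs).continuousOn.mul (h.shift hr).continuousOn) fun t ht => ?_
  refine (norm_mul_le _ _).trans ?_
  calc ‖ρ (s + t)‖ * ‖ρ (r + t)‖ ≤ (M * (1 + t)⁻¹) * M :=
        mul_le_mul ((h.shift hs).norm_le_mul_inv ht.le) ((h.shift hr).norm_le ht.le)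
          (norm_nonneg _) (mul_nonneg h.nonneg (by positivity))
    _ = M * M * (1 + t)⁻¹ := by ring

theorem integral_mul_self (h : IsResolventFamily ρ M) :
    ∫ t in Set.Ioi (0 : ℝ), (Real.sqrt t)⁻¹ • (ρ t * ρ t) =
      (1 / 2 : ℝ) • (ρ 0 * sqrtIntegral ρ 0) := by
  have hi := h.integrableOn le_rfl
  have hi2 := h.integrableOn_mul le_rfl le_rfl
  simp only [zero_add] at hi hi2
  have hi3 : IntegrableOn (fun t : ℝ => (1 / 2 : ℝ) • (ρ 0 * ((Real.sqrt t)⁻¹ • ρ t)))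
      (Set.Ioi 0) := (hi.const_mul (ρ 0)).smul (1 / 2 : ℝ)
  have hI : ∫ t in Set.Ioi (0 : ℝ), (1 / 2 : ℝ) • (ρ 0 * ((Real.sqrt t)⁻¹ • ρ t)) =
      (1 / 2 : ℝ) • (ρ 0 * sqrtIntegral ρ 0) := by
    rw [integral_smul, integral_const_mul_of_integrable hi]
    simp only [sqrtIntegral, zero_add]
  rw [← hI, ← sub_eq_zero, ← integral_sub hi2 hi3]
  have hd : ∀ x ∈ Set.Ioi (0 : ℝ), HasDerivAt (fun t => Real.sqrt t • (ρ 0 * ρ t))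
      ((Real.sqrt x)⁻¹ • (ρ x * ρ x) - (1 / 2 : ℝ) • (ρ 0 * ((Real.sqrt x)⁻¹ • ρ x))) x :=
    fun x hx => by
    have hx0 : 0 < x := hx
    have h1 : HasDerivAt ρ (-(ρ x * ρ x)) x :=
      (h.hasDerivWithinAt hx0.le).hasDerivAt (Ici_mem_nhds hx0)
    have h2 := (Real.hasDerivAt_sqrt hx0.ne').smul (h1.const_mul (ρ 0))
    refine h2.congr_deriv ?_
    have h3 := h.identity 0 x le_rfl hx0.le
    rw [sub_zero, sub_eq_iff_eq_add] at h3
    have h4 : ρ x * ρ x = ρ 0 * ρ x - x • (ρ 0 * (ρ x * ρ x)) := by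
      conv_rhs => enter [1, 1]; rw [h3]
      rw [add_mul, smul_mul_assoc, mul_assoc, add_sub_cancel_left]
    have h5 : (Real.sqrt x)⁻¹ * x = Real.sqrt x := by
      rw [inv_mul_eq_iff_eq_mul₀ (Real.sqrt_pos.2 hx0).ne', Real.mul_self_sqrt hx0.le]
    rw [show (Real.sqrt x)⁻¹ • (ρ x * ρ x) =
      (Real.sqrt x)⁻¹ • (ρ 0 * ρ x - x • (ρ 0 * (ρ x * ρ x))) by rw [← h4], smul_sub, smul_smul,
      h5, mul_smul_comm, smul_smul, mul_neg, smul_neg]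
    have h6 : (Real.sqrt x)⁻¹ • (ρ 0 * ρ x) =
        (1 / 2 * (Real.sqrt x)⁻¹) • (ρ 0 * ρ x) + (1 / (2 * Real.sqrt x)) • (ρ 0 * ρ x) := by
      rw [← add_smul]
      congr 1
      field_simp
      norm_num
    rw [h6]
    abel
  have hc : ContinuousWithinAt (fun t => Real.sqrt t • (ρ 0 * ρ t)) (Set.Ici 0) 0 :=
    (Real.continuous_sqrt.continuousWithinAt).smul
      (continuousWithinAt_const.mul (h.continuousOn 0 Set.self_mem_Ici))
  have hl : Tendsto (fun t => Real.sqrt t • (ρ 0 * ρ t)) atTop (nhds 0) := by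
    have hb : Tendsto (fun t : ℝ => M * M * (Real.sqrt t)⁻¹) atTop (nhds 0) := by
      simpa using (tendsto_inv_atTop_zero.comp Real.tendsto_sqrt_atTop).const_mul (M * M)
    refine squeeze_zero_norm' ?_ hb
    filter_upwards [eventually_gt_atTop 0] with t ht
    have hst : 0 < Real.sqrt t := Real.sqrt_pos.2 ht
    rw [norm_smul, Real.norm_of_nonneg hst.le]
    have h1 : ‖ρ 0 * ρ t‖ ≤ M * ‖ρ t‖ := (norm_mul_le _ _).trans
      (mul_le_mul_of_nonneg_right (h.norm_le le_rfl) (norm_nonneg _))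
    have h2 : t * ‖ρ t‖ ≤ M := le_trans
      (mul_le_mul_of_nonneg_right (by linarith) (norm_nonneg _)) (h.bound t ht.le)
    rw [← div_eq_mul_inv, le_div_iff₀ hst]
    calc Real.sqrt t * ‖ρ 0 * ρ t‖ * Real.sqrt t
        = (Real.sqrt t * Real.sqrt t) * ‖ρ 0 * ρ t‖ := by ring
      _ = t * ‖ρ 0 * ρ t‖ := by rw [Real.mul_self_sqrt ht.le]
      _ ≤ t * (M * ‖ρ t‖) := mul_le_mul_of_nonneg_left h1 ht.le
      _ = M * (t * ‖ρ t‖) := by ring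
      _ ≤ M * M := mul_le_mul_of_nonneg_left h2 h.nonneg
  rw [integral_Ioi_of_hasDerivAt_of_tendsto hc hd (hi2.sub hi3) hl]
  simp

theorem integral_mul_self_shift (h : IsResolventFamily ρ M) {s : ℝ} (hs : 0 ≤ s) :
    ∫ t in Set.Ioi (0 : ℝ), (Real.sqrt t)⁻¹ • (ρ (s + t) * ρ (s + t)) =
      (1 / 2 : ℝ) • (ρ s * sqrtIntegral ρ s) := by
  have := (h.shift hs).integral_mul_self
  simpa only [sqrtIntegral, zero_add, add_zero] using this

theorem commute_sqrtIntegral (h : IsResolventFamily ρ M) {s r : ℝ} (hs : 0 ≤ s) (hr : 0 ≤ r) :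
    ρ r * sqrtIntegral ρ s = sqrtIntegral ρ s * ρ r := by
  rw [sqrtIntegral, ← integral_const_mul_of_integrable (h.integrableOn hs),
    ← integral_mul_const_of_integrable (h.integrableOn hs)]
  refine setIntegral_congr_fun measurableSet_Ioi fun t ht => ?_
  have ht' : 0 < t := ht
  simp only [mul_smul_comm, smul_mul_assoc, h.commute hr (add_nonneg hs ht'.le)]

theorem hasDerivWithinAt_sqrtIntegral (h : IsResolventFamily ρ M) {s : ℝ} (hs : 0 ≤ s) :
    HasDerivWithinAt (sqrtIntegral ρ) (-((1 / 2 : ℝ) • (ρ s * sqrtIntegral ρ s)))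
      (Set.Ici 0) s := by
  refine hasDerivWithinAt_of_norm_sub_le_sq (C := M ^ 3 * (Real.pi / Real.sqrt 1)) ?_
  filter_upwards [self_mem_nhdsWithin] with y hy
  have hy0 : 0 ≤ y := hy
  rw [← h.integral_mul_self_shift hs, smul_neg, sub_neg_eq_add, ← integral_smul]
  have hA : IntegrableOn (fun t : ℝ => (Real.sqrt t)⁻¹ • ρ (y + t) - (Real.sqrt t)⁻¹ • ρ (s + t))
      (Set.Ioi 0) := (h.integrableOn hy0).sub (h.integrableOn hs)
  have hB : IntegrableOn (fun t : ℝ => (y - s) • (Real.sqrt t)⁻¹ • (ρ (s + t) * ρ (s + t)))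
      (Set.Ioi 0) := (h.integrableOn_mul hs hs).smul (y - s)
  rw [sqrtIntegral, sqrtIntegral, ← integral_sub (h.integrableOn hy0) (h.integrableOn hs),
    ← integral_add hA hB]
  have e : ∫ t in Set.Ioi (0 : ℝ), ((Real.sqrt t)⁻¹ • ρ (y + t) - (Real.sqrt t)⁻¹ • ρ (s + t) +
      (y - s) • (Real.sqrt t)⁻¹ • (ρ (s + t) * ρ (s + t))) =
      ∫ t in Set.Ioi (0 : ℝ), (Real.sqrt t)⁻¹ •
        ((y - s) • ((ρ (s + t) - ρ (y + t)) * ρ (s + t))) := by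
    refine setIntegral_congr_fun measurableSet_Ioi fun t ht => ?_
    have ht' : 0 < t := ht
    have h1 := h.identity (y + t) (s + t) (by positivity) (by positivity)
    rw [← smul_sub, h1, smul_comm (y - s), ← smul_add, add_sub_add_right_eq_sub, ← neg_sub y s,
      neg_smul, sub_mul, smul_sub]
    congr 1
    abel
  rw [e]
  refine (norm_integral_inv_sqrt_smul_le (C := M ^ 3 * ‖y - s‖ ^ 2) one_pos
    fun t ht => ?_).trans (le_of_eq (by ring))
  rw [norm_smul, Real.norm_eq_abs]
  have hst : 0 ≤ s + t := by positivity
  have hyt : 0 ≤ y + t := by positivity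
  have h1 := h.norm_sub_le hst hyt
  rw [add_sub_add_right_eq_sub, abs_sub_comm] at h1
  calc |y - s| * ‖(ρ (s + t) - ρ (y + t)) * ρ (s + t)‖
      ≤ |y - s| * (|y - s| * M ^ 2 * (M * (1 + t)⁻¹)) := by
        refine mul_le_mul_of_nonneg_left ((norm_mul_le _ _).trans ?_) (abs_nonneg _)
        exact mul_le_mul h1 ((h.shift hs).norm_le_mul_inv ht.le) (norm_nonneg _)
          (mul_nonneg (abs_nonneg _) (sq_nonneg _))
    _ = M ^ 3 * |y - s| ^ 2 * (1 + t)⁻¹ := by ring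

theorem sqrtIntegral_sq_mul_eq (h : IsResolventFamily ρ M) {s : ℝ} (hs : 0 ≤ s) :
    sqrtIntegral ρ s * sqrtIntegral ρ s * (1 + s • ρ 0) =
      sqrtIntegral ρ 0 * sqrtIntegral ρ 0 := by
  have hd : ∀ x : ℝ, 0 ≤ x → HasDerivWithinAt
      (fun s => sqrtIntegral ρ s * sqrtIntegral ρ s * (1 + s • ρ 0)) 0 (Set.Ici 0) x :=
    fun x hx => by
    have h1 := h.hasDerivWithinAt_sqrtIntegral hx
    have h2 := (h1.mul h1).mul
      (((hasDerivWithinAt_id x (Set.Ici 0)).smul_const (ρ 0)).const_add 1)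
    refine h2.congr_deriv ?_
    have hc := h.commute_sqrtIntegral hx hx
    have h3 := h.identity 0 x le_rfl hx
    have h4 : ρ 0 = ρ x * (1 + x • ρ 0) := by
      rw [sub_zero, sub_eq_iff_eq_add] at h3
      rw [mul_add, mul_one, mul_smul_comm, h.commute hx le_rfl, add_comm]
      exact h3
    set P := sqrtIntegral ρ x with hP
    have h5 : -((1 / 2 : ℝ) • (ρ x * P)) * P + P * -((1 / 2 : ℝ) • (ρ x * P)) =
        -(P * P * ρ x) := by
      rw [neg_mul, mul_neg, smul_mul_assoc, mul_smul_comm, hc, mul_assoc P (ρ x) P, hc,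
        ← mul_assoc, ← neg_add, ← add_smul]
      norm_num
    simp only [id, one_smul]
    rw [h5, neg_mul, mul_assoc (P * P) (ρ x), ← h4]
    exact neg_add_cancel (P * P * ρ 0)
  have := constant_of_has_deriv_right_zero (a := 0) (b := s)
    (f := fun s => sqrtIntegral ρ s * sqrtIntegral ρ s * (1 + s • ρ 0))
    (fun x hx => ((hd x hx.1).continuousWithinAt).mono Set.Icc_subset_Ici_self)
    (fun x hx => (hd x hx.1).mono (Set.Ici_subset_Ici.2 hx.1)) s ⟨hs, le_rfl⟩
  simpa using this

theorem norm_sqrtIntegral_le (h : IsResolventFamily ρ M) {s : ℝ} (hs : 0 < s) :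
    ‖sqrtIntegral ρ s‖ ≤ M * (Real.pi / Real.sqrt s) := by
  refine norm_integral_inv_sqrt_smul_le hs fun t ht => ?_
  refine (h.norm_le_mul_inv (by positivity)).trans ?_
  refine mul_le_mul_of_nonneg_left ?_ h.nonneg
  exact inv_anti₀ (by positivity) (by linarith)

theorem norm_sqrtIntegral_mul_sub_le (h : IsResolventFamily ρ M) {s : ℝ} (hs : 0 < s) :
    ‖sqrtIntegral ρ s * ρ 0 - (Real.pi / Real.sqrt s) • ρ 0‖ ≤
      M / s * (Real.pi / Real.sqrt s) := by
  have hi := (h.integrableOn hs.le).mul_const (ρ 0)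
  have hi2 := ((integrableOn_inv_sqrt_mul_inv_add hs).1).smul_const (ρ 0)
  have h0 : (Real.pi / Real.sqrt s) • ρ 0 =
      ∫ t in Set.Ioi (0 : ℝ), ((Real.sqrt t)⁻¹ * (s + t)⁻¹) • ρ 0 := by
    rw [integral_smul_const, (integrableOn_inv_sqrt_mul_inv_add hs).2]
  rw [sqrtIntegral, ← integral_mul_const_of_integrable (h.integrableOn hs.le),
    h0, ← integral_sub hi hi2]
  have e : ∫ t in Set.Ioi (0 : ℝ), ((Real.sqrt t)⁻¹ • ρ (s + t) * ρ 0 -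
      ((Real.sqrt t)⁻¹ * (s + t)⁻¹) • ρ 0) =
      ∫ t in Set.Ioi (0 : ℝ), (Real.sqrt t)⁻¹ • (-((s + t)⁻¹ • ρ (s + t))) := by
    refine setIntegral_congr_fun measurableSet_Ioi fun t ht => ?_
    have ht' : 0 < t := ht
    have hst : 0 < s + t := by positivity
    have h1 := h.identity 0 (s + t) le_rfl hst.le
    rw [mul_smul, smul_mul_assoc, ← smul_sub, h.commute hst.le le_rfl]
    congr 1
    rw [sub_zero] at h1
    rw [← smul_right_injective E hst.ne' |>.eq_iff, smul_sub, ← h1, smul_neg, smul_smul,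
      smul_smul, mul_inv_cancel₀ hst.ne', one_smul, one_smul]
    abel
  rw [e]
  refine norm_integral_inv_sqrt_smul_le hs fun t ht => ?_
  have hst : 0 < s + t := by positivity
  rw [norm_neg, norm_smul, Real.norm_of_nonneg (by positivity), mul_comm]
  refine mul_le_mul_of_nonneg_right ?_ (by positivity)
  rw [le_div_iff₀ hs, mul_comm]
  refine le_trans (mul_le_mul_of_nonneg_right ?_ (norm_nonneg _)) (h.bound (s + t) hst.le)
  linarith

theorem sqrtIntegral_mul_self (h : IsResolventFamily ρ M) :
    sqrtIntegral ρ 0 * sqrtIntegral ρ 0 = (Real.pi ^ 2) • ρ 0 := by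
  have hM := h.nonneg
  have hπ := Real.pi_pos
  have hb : ∀ s : ℝ, 0 < s → ‖sqrtIntegral ρ 0 * sqrtIntegral ρ 0 - (Real.pi ^ 2) • ρ 0‖ ≤
      (2 * M ^ 2 * Real.pi ^ 2 + M * Real.pi ^ 2) / s := fun s hs => by
    rw [← h.sqrtIntegral_sq_mul_eq hs.le]
    have hP := h.norm_sqrtIntegral_le hs
    have hδ := h.norm_sqrtIntegral_mul_sub_le hs
    set P := sqrtIntegral ρ s with hPdef
    set k := Real.pi / Real.sqrt s with hk
    have hks : s * (k * k) = Real.pi ^ 2 := by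
      rw [hk, div_mul_div_comm, Real.mul_self_sqrt hs.le]
      field_simp
    have hkp : 0 < k := div_pos hπ (Real.sqrt_pos.2 hs)
    set δ := P * ρ 0 - k • ρ 0 with hδdef
    have e : P * P * (1 + s • ρ 0) - (Real.pi ^ 2) • ρ 0 = P * P + s • (P * δ) +
        (s * k) • δ := by
      rw [← hks, hδdef]
      simp only [mul_add, mul_one, mul_smul_comm, mul_sub, smul_sub, smul_smul, mul_assoc]
      abel
    rw [e]
    have hkk : k * k = Real.pi ^ 2 / s := by
      rw [eq_div_iff hs.ne', mul_comm, hks]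
    have n1 : ‖P * P‖ ≤ (M * k) * (M * k) := (norm_mul_le _ _).trans
      (mul_le_mul hP hP (norm_nonneg _) (by positivity))
    have n2 : ‖s • (P * δ)‖ ≤ s * ((M * k) * (M / s * k)) := by
      rw [norm_smul, Real.norm_of_nonneg hs.le]
      exact mul_le_mul_of_nonneg_left ((norm_mul_le _ _).trans
        (mul_le_mul hP hδ (norm_nonneg _) (by positivity))) hs.le
    have n3 : ‖(s * k) • δ‖ ≤ (s * k) * (M / s * k) := by
      rw [norm_smul, Real.norm_of_nonneg (by positivity)]
      exact mul_le_mul_of_nonneg_left hδ (by positivity)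
    refine (norm_add₃_le.trans (add_le_add (add_le_add n1 n2) n3)).trans (le_of_eq ?_)
    calc _ = (k * k) * (2 * M ^ 2 + M) := by field_simp; ring
      _ = _ := by rw [hkk]; ring
  have hl : Tendsto (fun s : ℝ => (2 * M ^ 2 * Real.pi ^ 2 + M * Real.pi ^ 2) / s) atTop
      (nhds 0) := tendsto_const_nhds.div_atTop tendsto_id
  have h0 : ‖sqrtIntegral ρ 0 * sqrtIntegral ρ 0 - (Real.pi ^ 2) • ρ 0‖ ≤ 0 := ge_of_tendsto hl <| by
    filter_upwards [eventually_gt_atTop 0] with s hs using hb s hs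
  exact sub_eq_zero.1 (norm_le_zero_iff.1 h0)

end IsResolventFamily

end ResolventFamily

namespace IsResolventFamily

variable {E : Type*} [NormedRing E] [NormedAlgebra ℝ E] [CompleteSpace E] {ρ : ℝ → E} {M : ℝ}

theorem sqrtIntegral_comm_of_forall (h : IsResolventFamily ρ M) {X : E}
    (hX : ∀ t, 0 ≤ t → X * ρ t = ρ t * X) : X * sqrtIntegral ρ 0 = sqrtIntegral ρ 0 * X := by
  rw [sqrtIntegral, ← integral_const_mul_of_integrable (h.integrableOn le_rfl),
    ← integral_mul_const_of_integrable (h.integrableOn le_rfl)]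
  refine setIntegral_congr_fun measurableSet_Ioi fun t ht => ?_
  have ht' : 0 < t := ht
  simp only [mul_smul_comm, smul_mul_assoc, zero_add, hX t ht'.le]

/-- If `ρ' t = ρ t (1 + κ t)` then the square root of `ρ' 0` is a right multiple of the
square root `n` of `ρ 0`. -/
theorem exists_sqrtIntegral_eq_add_mul (h : IsResolventFamily ρ M) {ρ' κ : ℝ → E} {M' C : ℝ}
    (h' : IsResolventFamily ρ' M') {n : E} (hn : n * n = ρ 0)
    (hκ : ContinuousOn κ (Set.Ici 0)) (hκC : ∀ t, 0 ≤ t → ‖κ t‖ ≤ C * (1 + t)⁻¹)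
    (hρ : ∀ t, 0 ≤ t → ρ' t - ρ t = ρ t * κ t) :
    ∃ W, sqrtIntegral ρ' 0 = sqrtIntegral ρ 0 + n * W ∧
      ∀ X, X * n = n * X → (∀ t, 0 ≤ t → X * ρ t = ρ t * X) →
        (∀ t, 0 ≤ t → X * κ t = κ t * X) → X * W = W * X := by
  have hi : IntegrableOn (fun t : ℝ => (Real.sqrt t)⁻¹ • (n * (1 - t • ρ t) * κ t))
      (Set.Ioi 0) := by
    refine integrableOn_inv_sqrt_smul (C := ‖n‖ * (‖(1 : E)‖ + M) * C) ?_ fun t ht => ?_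
    · exact (continuousOn_const.mul (continuousOn_const.sub
        (continuousOn_id.smul h.continuousOn))).mul hκ
    · have h1 : ‖t • ρ t‖ ≤ M := by
        rw [norm_smul, Real.norm_of_nonneg ht.le]
        exact le_trans (mul_le_mul_of_nonneg_right (by linarith) (norm_nonneg _))
          (h.bound t ht.le)
      have h2 : ‖n * (1 - t • ρ t)‖ ≤ ‖n‖ * (‖(1 : E)‖ + M) :=
        (norm_mul_le _ _).trans (mul_le_mul_of_nonneg_left
          ((_root_.norm_sub_le _ _).trans (by linarith)) (norm_nonneg _))
      calc ‖n * (1 - t • ρ t) * κ t‖ ≤ ‖n * (1 - t • ρ t)‖ * ‖κ t‖ := norm_mul_le _ _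
        _ ≤ (‖n‖ * (‖(1 : E)‖ + M)) * (C * (1 + t)⁻¹) :=
          mul_le_mul h2 (hκC t ht.le) (norm_nonneg _)
            (mul_nonneg (norm_nonneg _) (add_nonneg (norm_nonneg _) h.nonneg))
        _ = _ := by ring
  refine ⟨∫ t in Set.Ioi (0 : ℝ), (Real.sqrt t)⁻¹ • (n * (1 - t • ρ t) * κ t), ?_, ?_⟩
  · rw [← integral_const_mul_of_integrable hi, ← sub_eq_iff_eq_add', sqrtIntegral, sqrtIntegral,
      ← integral_sub (h'.integrableOn le_rfl) (h.integrableOn le_rfl)]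
    refine setIntegral_congr_fun measurableSet_Ioi fun t ht => ?_
    have ht' : 0 < t := ht
    have h3 := h.identity 0 t le_rfl ht'.le
    simp only [zero_add]
    rw [← smul_sub, hρ t ht'.le, mul_smul_comm]
    congr 1
    rw [mul_assoc n, ← mul_assoc n n, hn, ← mul_assoc]
    congr 1
    rw [sub_zero] at h3
    rw [mul_sub, mul_one, mul_smul_comm, ← h3, sub_sub_cancel]
  · intro X hXn hXρ hXκ
    rw [← integral_const_mul_of_integrable hi, ← integral_mul_const_of_integrable hi]
    refine setIntegral_congr_fun measurableSet_Ioi fun t ht => ?_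
    have ht' : 0 < t := ht
    simp only [mul_smul_comm, smul_mul_assoc]
    congr 1
    have c1 : Commute X n := hXn
    have c2 : Commute X (1 - t • ρ t) :=
      (Commute.one_right X).sub_right ((show Commute X (ρ t) from hXρ t ht'.le).smul_right t)
    exact ((c1.mul_right c2).mul_right (hXκ t ht'.le)).eq

end IsResolventFamily

/-! ### Resolvents of unbounded operators -/

namespace IsResolvent

variable {A : H →ₗ.[ℂ] H} {z w : ℂ} {S T : H →L[ℂ] H}

/-- The resolvent identity. -/
theorem sub_eq (hS : IsResolvent A z S) (hT : IsResolvent A w T) :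
    S - T = (z - w) • (S * T) := by
  ext x
  obtain ⟨hx, e⟩ := hT.1 x
  have h := hS.2 ⟨T x, hx⟩
  have e2 : A ⟨T x, hx⟩ - z • T x = x - (z - w) • T x := by
    rw [sub_eq_iff_eq_add.1 e, sub_smul]
    abel
  simp only [e2, map_sub, map_smul] at h
  rw [sub_apply, smul_apply, mul_apply_eq_comp, sub_eq_iff_eq_add, ← sub_eq_iff_eq_add']
  exact h

theorem unique (hS : IsResolvent A z S) (hT : IsResolvent A z T) : S = T := by
  have := hS.sub_eq hT
  rwa [sub_self, zero_smul, sub_eq_zero] at this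

theorem injective (hS : IsResolvent A z S) : Function.Injective S := by
  rw [injective_iff_map_eq_zero]
  intro x hx
  obtain ⟨h, e⟩ := hS.1 x
  have h0 : (⟨S x, h⟩ : A.domain) = 0 := Subtype.ext hx
  rw [← e, h0, hx, smul_zero, sub_zero, A.map_zero]

theorem denseRange (hS : IsResolvent A z S) (hA : Dense (A.domain : Set H)) : DenseRange S :=
  hA.mono fun u hu => ⟨_, hS.2 ⟨u, hu⟩⟩

theorem res_eq (hS : IsResolvent A z S) : res A z = S := by
  have h : ∃ T, IsResolvent A z T := ⟨S, hS⟩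
  rw [res, dif_pos h]
  exact h.choose_spec.unique hS

end IsResolvent

theorem isResolvent_res {A : H →ₗ.[ℂ] H} {z : ℂ} (h : z ∈ resolventSetP A) :
    IsResolvent A z (res A z) := by
  obtain ⟨S, hS⟩ := h
  rwa [hS.res_eq]

theorem isResolvent_shiftP_iff {A : H →ₗ.[ℂ] H} {t z : ℂ} {T : H →L[ℂ] H} :
    IsResolvent (shiftP A t) z T ↔ IsResolvent A (z - t) T := by
  have h : ∀ u : A.domain, (shiftP A t) u - z • (u : H) = A u - (z - t) • (u : H) := fun u => by
    have : (shiftP A t) u = A u + t • (u : H) := rfl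
    rw [this, sub_smul]
    abel
  refine and_congr (forall_congr' fun x => exists_congr fun hx => ?_) (forall_congr' fun u => ?_)
  · exact ⟨fun e => (h ⟨T x, hx⟩).symm.trans e, fun e => (h ⟨T x, hx⟩).trans e⟩
  · rw [h u]

theorem res_shiftP (A : H →ₗ.[ℂ] H) (t z : ℂ) : res (shiftP A t) z = res A (z - t) := by
  have h : IsResolvent (shiftP A t) z = IsResolvent A (z - t) :=
    funext fun _ => propext isResolvent_shiftP_iff
  exact congrArg (fun P : (H →L[ℂ] H) → Prop => if h : ∃ T, P T then h.choose else 0) h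

theorem mem_resolventSetP_shiftP {A : H →ₗ.[ℂ] H} {t z : ℂ} :
    z ∈ resolventSetP (shiftP A t) ↔ z - t ∈ resolventSetP A :=
  exists_congr fun _ => isResolvent_shiftP_iff

/-- The ray `z - [0, ∞)` lies in the resolvent set, with `(1 + t)‖(A - z + t)⁻¹‖ ≤ M`. -/
def IsRegularRay (A : H →ₗ.[ℂ] H) (z : ℂ) (M : ℝ) : Prop :=
  ∀ t : ℝ, 0 ≤ t → IsResolvent A (z - t) (res A (z - t)) ∧ (1 + t) * ‖res A (z - t)‖ ≤ M

theorem eq_of_sandwich_eq {N X X' : H →L[ℂ] H} (hi : Function.Injective N) (hd : DenseRange N)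
    (h : N * X * N = N * X' * N) : X = X' := by
  refine DFunLike.coe_injective (hd.equalizer X.continuous X'.continuous (funext fun x => hi ?_))
  exact DFunLike.congr_fun h x

namespace IsRegularRay

variable {A : H →ₗ.[ℂ] H} {z ζ : ℂ} {M M' : ℝ}

theorem isResolvent (h : IsRegularRay A z M) : IsResolvent A z (res A z) := by
  have := (h 0 le_rfl).1
  rwa [Complex.ofReal_zero, sub_zero] at this

theorem isResolventFamily (h : IsRegularRay A z M) :
    IsResolventFamily (fun t : ℝ => res A (z - t)) M where
  identity s t hs ht := by
    rw [(h s hs).1.sub_eq (h t ht).1, sub_sub_sub_cancel_left, ← Complex.ofReal_sub,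
      Complex.coe_smul]
  bound t ht := (h t ht).2

theorem negSqrt_eq (A : H →ₗ.[ℂ] H) (z : ℂ) :
    negSqrt A z = Real.pi⁻¹ • sqrtIntegral (fun t : ℝ => res A (z - t)) 0 := by
  simp only [negSqrt, sqrtIntegral, ← Complex.ofReal_inv, Complex.coe_smul, zero_add]

theorem negSqrt_mul_self (h : IsRegularRay A z M) : negSqrt A z * negSqrt A z = res A z := by
  rw [negSqrt_eq, smul_mul_smul_comm, h.isResolventFamily.sqrtIntegral_mul_self, smul_smul]
  have : Real.pi⁻¹ * Real.pi⁻¹ * Real.pi ^ 2 = 1 := by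
    have := Real.pi_ne_zero
    field_simp
  rw [this, one_smul, Complex.ofReal_zero, sub_zero]

theorem negSqrt_injective (h : IsRegularRay A z M) : Function.Injective (negSqrt A z) := by
  have := h.isResolvent.injective
  rw [← h.negSqrt_mul_self] at this
  exact Function.Injective.of_comp (f := negSqrt A z) (g := negSqrt A z) this

theorem negSqrt_denseRange (h : IsRegularRay A z M) (hA : Dense (A.domain : Set H)) :
    DenseRange (negSqrt A z) := by
  have := h.isResolvent.denseRange hA
  rw [← h.negSqrt_mul_self] at this
  exact Dense.mono (by rintro _ ⟨x, rfl⟩; exact ⟨negSqrt A z x, rfl⟩) this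

theorem negSqrt_comm_of_forall (h : IsRegularRay A z M) {X : H →L[ℂ] H}
    (hX : ∀ t : ℝ, 0 ≤ t → X * res A (z - t) = res A (z - t) * X) :
    X * negSqrt A z = negSqrt A z * X := by
  rw [negSqrt_eq, mul_smul_comm, smul_mul_assoc, h.isResolventFamily.sqrtIntegral_comm_of_forall hX]

theorem res_comm {v w : ℂ} {S T : H →L[ℂ] H} (hS : IsResolvent A v S) (hT : IsResolvent A w T) :
    S * T = T * S := by
  rcases eq_or_ne v w with rfl | hvw
  · rw [hS.unique hT]
  have h1 := hS.sub_eq hT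
  have h2 := hT.sub_eq hS
  rw [← neg_sub, h1, ← neg_smul, neg_sub] at h2
  exact smul_right_injective _ (sub_ne_zero.2 hvw.symm) h2

theorem exists_negSqrt_eq_mul (h : IsRegularRay A z M) (h' : IsRegularRay A ζ M') :
    ∃ Y : H →L[ℂ] H, negSqrt A ζ = negSqrt A z * Y ∧ negSqrt A ζ = Y * negSqrt A z := by
  have hN := h.negSqrt_mul_self
  have hf := h.isResolventFamily
  have hf' := h'.isResolventFamily
  have hNρ : ∀ t : ℝ, 0 ≤ t → negSqrt A z * res A (z - t) = res A (z - t) * negSqrt A z :=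
    fun t ht => (h.negSqrt_comm_of_forall fun s hs => res_comm (h t ht).1 (h s hs).1).symm
  have hNκ : ∀ t : ℝ, 0 ≤ t → negSqrt A z * ((ζ - z) • res A (ζ - t)) =
      ((ζ - z) • res A (ζ - t)) * negSqrt A z := fun t ht => by
    rw [mul_smul_comm, smul_mul_assoc,
      h.negSqrt_comm_of_forall fun s hs => res_comm (h' t ht).1 (h s hs).1]
  obtain ⟨W, hW, hWc⟩ := hf.exists_sqrtIntegral_eq_add_mul hf' (n := negSqrt A z)
    (κ := fun t : ℝ => (ζ - z) • res A (ζ - t)) (C := ‖ζ - z‖ * M')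
    (by rw [hN, Complex.ofReal_zero, sub_zero])
    (hf'.continuousOn.const_smul (ζ - z))
    (fun t ht => by
      rw [norm_smul, mul_assoc]
      exact mul_le_mul_of_nonneg_left (hf'.norm_le_mul_inv ht) (norm_nonneg _))
    (fun t ht => by
      rw [(h' t ht).1.sub_eq (h t ht).1, sub_sub_sub_cancel_right, mul_smul_comm,
        res_comm (h' t ht).1 (h t ht).1])
  have hWN := hWc _ rfl hNρ hNκ
  have e : negSqrt A ζ = negSqrt A z * (1 + Real.pi⁻¹ • W) := by
    rw [negSqrt_eq A ζ, hW, smul_add, ← negSqrt_eq A z, mul_add, mul_one, mul_smul_comm]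
  refine ⟨1 + Real.pi⁻¹ • W, e, ?_⟩
  rw [e, mul_add, add_mul, mul_one, one_mul, mul_smul_comm, smul_mul_assoc, hWN]

theorem exists_negSqrt_eq_mul_unit (h : IsRegularRay A z M) (h' : IsRegularRay A ζ M') :
    ∃ Y Y' : H →L[ℂ] H, Y * Y' = 1 ∧ Y' * Y = 1 ∧
      negSqrt A ζ = negSqrt A z * Y ∧ negSqrt A ζ = Y * negSqrt A z := by
  obtain ⟨Y, h1, h2⟩ := h.exists_negSqrt_eq_mul h'
  obtain ⟨Y', h1', h2'⟩ := h'.exists_negSqrt_eq_mul h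
  have cancel : ∀ {v : ℂ} {K : ℝ} {X : H →L[ℂ] H}, IsRegularRay A v K →
      negSqrt A v * X = negSqrt A v → X = 1 := fun {v K X} hv e => by
    ext x
    exact hv.negSqrt_injective (DFunLike.congr_fun e x)
  refine ⟨Y, Y', cancel h ?_, cancel h' ?_, h1, h2⟩
  · rw [← mul_assoc, ← h1, ← h1']
  · rw [← mul_assoc, ← h1', ← h1]

end IsRegularRay

/-! ### Sectors -/

theorem lt_norm_mul_cos_of_notMem_closure_sectorS {ω : ℝ} (h0 : 0 ≤ ω) (hπ : ω < Real.pi) {w : ℂ}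
    (hw : w ∉ closure (sectorS ω)) : w.re < ‖w‖ * Real.cos ω := by
  contrapose! hw
  have key : ∀ ε : ℝ, 0 < ε → w + ε ∈ sectorS ω := fun ε hε => by
    rcases h0.eq_or_lt with rfl | h0'
    · rw [sectorS, if_pos rfl]
      rw [Real.cos_zero, mul_one] at hw
      have hre : w.re = ‖w‖ := le_antisymm (Complex.re_le_norm w) hw
      have hww : w = (‖w‖ : ℂ) := by
        have := Complex.re_eq_norm.1 hre
        rw [← hre]
        exact Complex.eq_re_of_ofReal_le this
      refine ⟨‖w‖ + ε, add_pos_of_nonneg_of_pos (norm_nonneg _) hε, ?_⟩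
      push_cast
      rw [← hww]
    · rw [sectorS, if_neg h0'.ne']
      have hc1 : Real.cos ω < 1 := by
        rw [← Real.cos_zero]
        exact Real.cos_lt_cos_of_nonneg_of_le_pi le_rfl hπ.le h0'
      have hc2 : -1 < Real.cos ω := by
        rw [← Real.cos_pi]
        exact Real.cos_lt_cos_of_nonneg_of_le_pi h0 le_rfl hπ
      have n1 : ‖w + ε‖ ≤ ‖w‖ + ε := (norm_add_le _ _).trans_eq (by
        rw [Complex.norm_real, Real.norm_of_nonneg hε.le])
      have n2 : ‖w‖ ≤ ‖w + ε‖ + ε := by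
        have := norm_sub_le (w + ε) (ε : ℂ)
        rwa [add_sub_cancel_right, Complex.norm_real, Real.norm_of_nonneg hε.le] at this
      have hlt : ‖w + ε‖ * Real.cos ω < (w + ε).re := by
        rw [Complex.add_re, Complex.ofReal_re]
        rcases le_total 0 (Real.cos ω) with h | h <;> nlinarith
      have hne : w + ε ≠ 0 := fun h => by simp [h] at hlt
      refine ⟨hne, ?_⟩
      rw [← Complex.norm_mul_cos_arg] at hlt
      have hcos := lt_of_mul_lt_mul_left hlt (norm_nonneg _)
      rw [← Real.cos_abs (Complex.arg _)] at hcos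
      by_contra! hge
      exact absurd (Real.cos_le_cos_of_nonneg_of_le_pi h0 (Complex.abs_arg_le_pi _) hge)
        (not_le.2 hcos)
  have hl : Tendsto (fun ε : ℝ => w + ε) (nhdsWithin 0 (Set.Ioi 0)) (nhds w) := by
    have : Continuous fun ε : ℝ => w + ε := by fun_prop
    simpa using (this.tendsto 0).mono_left nhdsWithin_le_nhds
  exact mem_closure_of_tendsto hl (by
    filter_upwards [self_mem_nhdsWithin] with ε hε using key ε hε)

theorem notMem_closure_sectorS_of_lt {ω : ℝ} (hπ : ω < Real.pi) {w : ℂ}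
    (hw : w.re < ‖w‖ * Real.cos ω) : w ∉ closure (sectorS ω) := by
  intro hmem
  refine absurd hw (not_lt.2 ?_)
  have hcl : IsClosed {v : ℂ | ‖v‖ * Real.cos ω ≤ v.re} :=
    isClosed_le (by fun_prop) Complex.continuous_re
  refine closure_minimal (fun v hv => ?_) hcl hmem
  rw [sectorS] at hv
  split_ifs at hv with h
  · obtain ⟨x, hx, rfl⟩ := hv
    have hx' : 0 < x := hx
    simp [h, abs_of_pos hx']
  · rw [Set.mem_ofPred_eq, ← Complex.norm_mul_cos_arg v, ← Real.cos_abs (Complex.arg v)]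
    exact mul_le_mul_of_nonneg_left
      (Real.cos_le_cos_of_nonneg_of_le_pi (abs_nonneg _) hπ.le hv.2.le) (norm_nonneg _)

theorem sub_re_lt_norm_mul_cos {ω : ℝ} {w : ℂ} (hw : w.re < ‖w‖ * Real.cos ω) {t : ℝ}
    (ht : 0 ≤ t) : (w - t).re < ‖w - t‖ * Real.cos ω := by
  rw [Complex.sub_re, Complex.ofReal_re]
  have n1 : ‖w - t‖ ≤ ‖w‖ + t := (norm_sub_le _ _).trans_eq (by
    rw [Complex.norm_real, Real.norm_of_nonneg ht])
  have n2 : ‖w‖ ≤ ‖w - t‖ + t := by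
    have := norm_add_le (w - t) (t : ℂ)
    rwa [sub_add_cancel, Complex.norm_real, Real.norm_of_nonneg ht] at this
  have c1 := Real.cos_le_one ω
  have c2 := Real.neg_one_le_cos ω
  rcases le_total 0 (Real.cos ω) with h | h <;> nlinarith

theorem IsSectorialP.exists_isRegularRay {A : H →ₗ.[ℂ] H} {t0 ω : ℝ} (h0 : 0 ≤ ω)
    (hπ : ω < Real.pi) (hA : IsSectorialP (shiftP A (t0 : ℂ)) ω) {z : ℂ}
    (hz : z ∈ offSector t0 ω) : ∃ M, IsRegularRay A z M := by
  set w : ℂ := z + t0 with hw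
  have hwz : ∀ t : ℝ, w - t - t0 = z - t := fun t => by rw [hw]; ring
  have hwn : w ∉ closure (sectorS ω) := fun hmem => hz <| by
    have := image_closure_subset_closure_image (f := fun v : ℂ => -(t0 : ℂ) + v) (by fun_prop)
      (Set.mem_image_of_mem _ hmem)
    simpa [hw, shiftedSector] using this
  have hlt := lt_norm_mul_cos_of_notMem_closure_sectorS h0 hπ hwn
  obtain ⟨ω', hω', hlt', hωπ⟩ : ∃ ω', ω < ω' ∧ w.re < ‖w‖ * Real.cos ω' ∧ ω' < Real.pi := by
    have h1 : ∀ᶠ x in nhds ω, w.re < ‖w‖ * Real.cos x :=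
      (isOpen_lt continuous_const (by fun_prop)).mem_nhds hlt
    have h2 : ∀ᶠ x in nhdsWithin ω (Set.Ioi ω),
        ω < x ∧ w.re < ‖w‖ * Real.cos x ∧ x < Real.pi := by
      filter_upwards [self_mem_nhdsWithin, nhdsWithin_le_nhds h1,
        nhdsWithin_le_nhds (Iio_mem_nhds hπ)] with x a1 a2 a3 using ⟨a1, a2, a3⟩
    exact h2.exists
  obtain ⟨K, hK⟩ := hA.2 ω' hω' hωπ
  obtain ⟨δ, hδ, hball⟩ : ∃ δ > 0, ∀ v : ℂ, ‖v - w‖ < δ → v.re < ‖v‖ * Real.cos ω' := by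
    have h1 : {v : ℂ | v.re < ‖v‖ * Real.cos ω'} ∈ nhds w :=
      (isOpen_lt Complex.continuous_re (by fun_prop)).mem_nhds hlt'
    obtain ⟨δ, hδ, h⟩ := Metric.mem_nhds_iff.1 h1
    exact ⟨δ, hδ, fun v hv => h (by rwa [Metric.mem_ball, dist_eq_norm])⟩
  have hdist : ∀ t : ℝ, 0 ≤ t → δ ≤ ‖w - t‖ := fun t ht => by
    by_contra! hlt2
    rw [norm_sub_rev] at hlt2
    have := hball t hlt2
    rw [Complex.ofReal_re, Complex.norm_real, Real.norm_of_nonneg ht] at this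
    nlinarith [Real.cos_le_one ω']
  refine ⟨((1 + ‖w‖) / δ + 1) * K, fun t ht => ⟨isResolvent_res ?_, ?_⟩⟩
  · rw [← hwz t, ← mem_resolventSetP_shiftP]
    by_contra hmem
    exact notMem_closure_sectorS_of_lt hπ (sub_re_lt_norm_mul_cos hlt ht) (hA.1 hmem)
  · have hb := hK (w - t)
      (notMem_closure_sectorS_of_lt hωπ (sub_re_lt_norm_mul_cos hlt' ht))
    rw [res_shiftP, hwz] at hb
    have h1 : 1 + t ≤ ((1 + ‖w‖) / δ + 1) * ‖w - t‖ := by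
      have h2 : t ≤ ‖w‖ + ‖w - t‖ := by
        have := norm_sub_le w (w - t)
        rwa [sub_sub_cancel, Complex.norm_real, Real.norm_of_nonneg ht] at this
      have h3 : 1 + ‖w‖ ≤ (1 + ‖w‖) / δ * ‖w - t‖ := by
        rw [div_mul_eq_mul_div, le_div_iff₀ hδ]
        exact mul_le_mul_of_nonneg_left (hdist t ht) (by positivity)
      linarith
    calc (1 + t) * ‖res A (z - t)‖
        ≤ ((1 + ‖w‖) / δ + 1) * ‖w - t‖ * ‖res A (z - t)‖ :=
          mul_le_mul_of_nonneg_right h1 (norm_nonneg _)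
      _ = ((1 + ‖w‖) / δ + 1) * (‖w - t‖ * ‖res A (z - t)‖) := mul_assoc _ _ _
      _ ≤ ((1 + ‖w‖) / δ + 1) * K := mul_le_mul_of_nonneg_left hb (by positivity)

theorem IsPositiveTypeP.exists_isRegularRay {A : H →ₗ.[ℂ] H} {t0 t1 : ℝ} (h : t0 ≤ t1)
    (hA : IsPositiveTypeP (shiftP A (t0 : ℂ))) : ∃ M, IsRegularRay A (-(t1 : ℂ)) M := by
  obtain ⟨M, hM⟩ := hA.2
  refine ⟨M, fun t ht => ?_⟩
  have e : -((t + t1 - t0 : ℝ) : ℂ) - t0 = -(t1 : ℂ) - t := by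
    push_cast
    ring
  constructor
  · have h1 := hA.1 (-(t + t1 - t0)) (by linarith)
    rw [mem_resolventSetP_shiftP, Complex.ofReal_neg, e] at h1
    exact isResolvent_res h1
  · have h2 := hM (t + t1 - t0) (by linarith)
    rw [res_shiftP, e] at h2
    exact le_trans (mul_le_mul_of_nonneg_right (by linarith) (norm_nonneg _)) h2

/-! ### Moving the base point -/

/-- If `N D N` and `N_v D_v N_v` are the resolvents of `A₀` at `ζ` and `v`, where `N`, `N_v` are
the inverse square roots of `A - ζ` and `A - v`, then `D_v - 1` is similar to
`(1 + T) (1 + (v - ζ) Q R T) - 1`, with `T = D - 1` and `R` the resolvent of `A` at `ζ`. -/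
theorem IsRegularRay.exists_sub_one_eq {A A0 : H →ₗ.[ℂ] H} {ζ v : ℂ} {M M' : ℝ}
    (hA : Dense (A.domain : Set H)) (hζ : IsRegularRay A ζ M) (hv : IsRegularRay A v M')
    {R0 P : H →L[ℂ] H} (hR0 : IsResolvent A0 ζ R0) (hP : IsResolvent A0 v P)
    {Dζ Dv : H →L[ℂ] H} (hDζ : negSqrt A ζ * Dζ * negSqrt A ζ = R0)
    (hDv : negSqrt A v * Dv * negSqrt A v = P) :
    ∃ Y Y' : H →L[ℂ] H, Y * Y' = 1 ∧
      Dv - 1 = Y' * ((Dζ - 1) +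
        (v - ζ) • ((1 + (v - ζ) • (negSqrt A ζ * (1 + (v - ζ) • P) * (negSqrt A ζ * Dζ))) *
          (res A ζ * (Dζ - 1))) + (Dζ - 1) *
        ((v - ζ) • ((1 + (v - ζ) • (negSqrt A ζ * (1 + (v - ζ) • P) * (negSqrt A ζ * Dζ))) *
          (res A ζ * (Dζ - 1))))) * Y := by
  obtain ⟨Y, Y', hYY', hY'Y, hY1, hY2⟩ := hζ.exists_negSqrt_eq_mul_unit hv
  have hN := hζ.negSqrt_mul_self
  have hNv := hv.negSqrt_mul_self
  have hinj := hζ.negSqrt_injective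
  have hdr := hζ.negSqrt_denseRange hA
  have hRv := hv.isResolvent.sub_eq hζ.isResolvent
  have hP1 := hP.sub_eq hR0
  have hP2 := hR0.sub_eq hP
  set c := v - ζ with hc
  rw [← neg_sub v ζ, ← hc] at hP2
  set N := negSqrt A ζ with hNdef
  set Nv := negSqrt A v with hNvdef
  set R := res A ζ with hRdef
  set U := N * (1 + c • P) with hU
  set V := N * Dζ with hV
  have hP2' : R0 + c • (R0 * P) = P := by
    rw [neg_smul, sub_eq_iff_eq_add] at hP2
    nth_rewrite 1 [hP2]
    abel
  have hP1' : P - c • (P * R0) = R0 := by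
    rw [← hP1]
    abel
  have hVN : V * N = R0 := hDζ
  have hNVU : N * V * U = N * P := by
    rw [hU, ← mul_assoc, mul_assoc N V N, hVN, mul_assoc, mul_add, mul_one, mul_smul_comm, hP2']
  have hUNV : U * V * (N * V) = N * P * V := by
    have hP3 : (1 + c • P) * R0 = P := by
      rw [add_mul, one_mul, smul_mul_assoc, ← hP1, add_sub_cancel]
    rw [hU, ← mul_assoc, mul_assoc _ V N, hVN, mul_assoc N, hP3]
  have hRD : R * Dζ = N * V := by rw [← hN, hV, mul_assoc]
  have hUV : U * V = N * V + c • (N * P * V) := by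
    rw [hU, mul_add, mul_one, add_mul, mul_smul_comm, smul_mul_assoc]
  set Q := 1 + c • (U * V) with hQ
  have hQr : (1 - c • (N * V)) * Q = 1 := by
    have e : (1 - c • (N * V)) * Q = 1 - c • (N * V) + c • (U * V) - (c * c) • (N * V * U * V) := by
      rw [hQ]
      simp only [mul_add, sub_mul, mul_one, one_mul, smul_mul_assoc, mul_smul_comm, mul_assoc]
      module
    rw [e, hNVU, hUV]
    module
  have hQl : Q * (1 - c • (N * V)) = 1 := by
    have e : Q * (1 - c • (N * V)) =
        1 - c • (N * V) + c • (U * V) - (c * c) • (U * V * (N * V)) := by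
      rw [hQ]
      simp only [add_mul, mul_sub, mul_one, one_mul, smul_mul_assoc, mul_smul_comm]
      module
    rw [e, hUNV, hUV]
    module
  have hYY : Y * Y * (1 - c • R) = 1 := by
    refine eq_of_sandwich_eq hinj hdr ?_
    have e1 : (1 - c • R) * N = N * (1 - c • R) := by
      rw [← hN]
      simp only [sub_mul, mul_sub, one_mul, mul_one, smul_mul_assoc, mul_smul_comm, mul_assoc]
    calc N * (Y * Y * (1 - c • R)) * N = N * Y * Y * ((1 - c • R) * N) := by noncomm_ring
      _ = (N * Y) * (Y * N) * (1 - c • R) := by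
        rw [e1]
        simp only [mul_assoc]
      _ = res A v - c • (res A v * R) := by
        rw [← hY1, ← hY2, hNv, mul_sub, mul_one, mul_smul_comm]
      _ = N * 1 * N := by
        rw [← hRv, sub_sub_cancel, mul_one, hN]
  have hYDY : Y * Dv * Y * (1 - c • (N * V)) = Dζ := by
    refine eq_of_sandwich_eq hinj hdr ?_
    have e1 : (1 - c • (N * V)) * N = N * (1 - c • R0) := by
      rw [sub_mul, mul_sub, one_mul, mul_one, smul_mul_assoc, mul_smul_comm, mul_assoc, hVN]
    calc N * (Y * Dv * Y * (1 - c • (N * V))) * N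
        = N * Y * Dv * Y * ((1 - c • (N * V)) * N) := by simp only [mul_assoc]
      _ = (N * Y) * Dv * (Y * N) * (1 - c • R0) := by
        rw [e1]
        simp only [mul_assoc]
      _ = P * (1 - c • R0) := by rw [← hY1, ← hY2, hDv]
      _ = N * Dζ * N := by rw [mul_sub, mul_one, mul_smul_comm, hP1', ← hVN]
  have hDvQ : Dv = Y' * (Dζ * Q) * Y' := by
    rw [← hYDY, mul_assoc (Y * Dv * Y), hQr, mul_one, ← mul_assoc, ← mul_assoc, hY'Y, one_mul,
      mul_assoc, hYY', mul_one]
  have hY'c : Y' = (1 - c • R) * Y := by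
    have e1 : Y' * Y' = 1 - c • R := by
      calc Y' * Y' = Y' * Y' * (Y * Y * (1 - c • R)) := by rw [hYY, mul_one]
        _ = Y' * (Y' * Y) * Y * (1 - c • R) := by simp only [mul_assoc]
        _ = 1 - c • R := by rw [hY'Y, mul_one, hY'Y, one_mul]
    rw [← e1, mul_assoc, hY'Y, mul_one]
  have hQR : Q * (1 - c • R) = 1 + c • (Q * (R * (Dζ - 1))) := by
    have e1 : 1 - c • R = (1 - c • (N * V)) + c • (R * (Dζ - 1)) := by
      rw [← hRD, mul_sub, mul_one]
      module
    rw [e1, mul_add, hQl, mul_smul_comm]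
  refine ⟨Y, Y', hYY', ?_⟩
  calc Dv - 1 = Y' * (Dζ * Q) * ((1 - c • R) * Y) - Y' * Y := by rw [← hY'c, ← hDvQ, hY'Y]
    _ = Y' * (Dζ * (Q * (1 - c • R)) - 1) * Y := by
      simp only [mul_sub, sub_mul, mul_assoc, mul_one, one_mul]
    _ = _ := by
      rw [hQR]
      congr 2
      generalize c • (Q * (R * (Dζ - 1))) = Z
      noncomm_ring

/-! ### The derivative of the determinant -/

theorem TraceBound.norm_detI_smul_one_add_mul_sub_le {L G : H →L[ℂ] H} {B g : ℝ}
    (hL : TraceBound L B) (hG : ‖G‖ ≤ g) (b : HilbertBasis ℕ ℂ H) {c : ℂ} (hc : ‖c‖ < 1) :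
    ‖detI b (c • ((1 + c • G) * L)) - (1 + c * traceH b L)‖ ≤
      (Real.exp ((B + 2 * g * B) + (B + 2 * g * B) ^ 2) + (B + 2 * g * B) + 1 + 2 * g * B) *
        ‖c‖ ^ 2 := by
  have hB := hL.nonneg
  have hg : 2 * ‖G‖ * B ≤ 2 * g * B := by gcongr
  have hGL := (hL.mul_left G).mono hg
  have hgB := hGL.nonneg
  have hcGL := hGL.smul c
  have hK : TraceBound ((1 + c • G) * L) (B + 2 * g * B) := by
    rw [add_mul, one_mul, smul_mul_assoc]
    exact (hL.add hcGL).mono (by nlinarith)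
  have htr : traceH b ((1 + c • G) * L) = traceH b L + traceH b (c • (G * L)) := by
    rw [add_mul, one_mul, smul_mul_assoc, hL.traceH_add hcGL]
  have h1 := hK.norm_detI_smul_sub_le b hc
  have h2 : ‖c * traceH b (c • (G * L))‖ ≤ 2 * g * B * ‖c‖ ^ 2 := by
    rw [norm_mul]
    calc ‖c‖ * ‖traceH b (c • (G * L))‖ ≤ ‖c‖ * (‖c‖ * (2 * g * B)) := by
          gcongr
          exact hcGL.norm_traceH_le b
      _ = 2 * g * B * ‖c‖ ^ 2 := by ring
  calc ‖detI b (c • ((1 + c • G) * L)) - (1 + c * traceH b L)‖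
      = ‖(detI b (c • ((1 + c • G) * L)) - (1 + c * traceH b ((1 + c • G) * L))) +
          c * traceH b (c • (G * L))‖ := by
        rw [htr]
        congr 1
        ring
    _ ≤ _ := (norm_add_le _ _).trans (add_le_add h1 h2)
    _ = _ := by ring

theorem IsRegularRay.isTraceClass_sub_one {A A0 : H →ₗ.[ℂ] H} {ζ v : ℂ} {M M' : ℝ}
    (hA : Dense (A.domain : Set H)) (hζ : IsRegularRay A ζ M) (hv : IsRegularRay A v M')
    {R0 P : H →L[ℂ] H} (hR0 : IsResolvent A0 ζ R0) (hP : IsResolvent A0 v P)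
    {Dζ Dv : H →L[ℂ] H} (hDζ : negSqrt A ζ * Dζ * negSqrt A ζ = R0)
    (hDv : negSqrt A v * Dv * negSqrt A v = P) (hT : IsTraceClass (Dζ - 1)) :
    IsTraceClass (Dv - 1) := by
  obtain ⟨B, hB⟩ := hT
  replace hB : TraceBound (Dζ - 1) B := hB
  obtain ⟨Y, Y', -, hY⟩ := hζ.exists_sub_one_eq hA hv hR0 hP hDζ hDv
  rw [hY]
  have hK := fun G => ((hB.mul_left (res A ζ)).mul_left G).smul (v - ζ)
  exact ((((hB.add (hK _)).add ((hK _).mul_left _)).mul_left Y').mul_right Y).isTraceClass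

theorem IsResolvent.norm_le_two_mul {A : H →ₗ.[ℂ] H} {z w : ℂ} {S T : H →L[ℂ] H}
    (hS : IsResolvent A z S) (hT : IsResolvent A w T) (h : ‖z - w‖ * ‖T‖ ≤ 1 / 2) :
    ‖S‖ ≤ 2 * ‖T‖ := by
  have h1 : S = T + (z - w) • (S * T) := by rw [← hS.sub_eq hT, add_sub_cancel]
  have h2 : ‖S‖ ≤ ‖T‖ + ‖z - w‖ * (‖S‖ * ‖T‖) := by
    calc ‖S‖ = ‖T + (z - w) • (S * T)‖ := congrArg _ h1
      _ ≤ ‖T‖ + ‖z - w‖ * (‖S‖ * ‖T‖) := by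
        refine (norm_add_le _ _).trans ?_
        rw [norm_smul]
        gcongr
        exact norm_mul_le _ _
  nlinarith [norm_nonneg S]

theorem traceH_neg (b : HilbertBasis ℕ ℂ H) (T : H →L[ℂ] H) : traceH b (-T) = -traceH b T := by
  simp [traceH, tsum_neg]

theorem hasDerivWithinAt_detI_sub_one {A A0 : H →ₗ.[ℂ] H} {S : Set ℂ} {D : ℂ → H →L[ℂ] H}
    (hA : Dense (A.domain : Set H)) (hS : ∀ v ∈ S, ∃ M, IsRegularRay A v M)
    (hS0 : ∀ v ∈ S, IsResolvent A0 v (res A0 v))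
    (hD : ∀ v ∈ S, negSqrt A v * D v * negSqrt A v = res A0 v) {z : ℂ} (hz : z ∈ S) {B : ℝ}
    (hT : TraceBound (D z - 1) B) (b : HilbertBasis ℕ ℂ H) :
    HasDerivWithinAt (fun w => detI b (D w - 1))
      (detI b (D z - 1) * traceH b (res A z * (D z - 1))) S z := by
  obtain ⟨M, hM⟩ := hS z hz
  have hL := hT.mul_left (res A z)
  set N := negSqrt A z with hN
  set r : ℝ := ‖res A0 z‖ + 1 with hr
  have hr0 : 0 < r := by positivity
  set g : ℝ := ‖N‖ * (1 + 2 * r) * (‖N‖ * ‖D z‖) with hg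
  set B' : ℝ := 2 * ‖res A z‖ * B with hB'
  refine hasDerivWithinAt_of_norm_sub_le_sq (C := ‖detI b (D z - 1)‖ *
    (Real.exp ((B' + 2 * g * B') + (B' + 2 * g * B') ^ 2) + (B' + 2 * g * B') + 1 +
      2 * g * B')) ?_
  have hball : Metric.ball z (min 1 (1 / (2 * r))) ∈ nhdsWithin z S :=
    mem_nhdsWithin_of_mem_nhds (Metric.ball_mem_nhds z (lt_min one_pos (by positivity)))
  filter_upwards [self_mem_nhdsWithin, hball] with v hv hvz
  rw [Metric.mem_ball, dist_eq_norm, lt_min_iff] at hvz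
  obtain ⟨hc1, hc2⟩ := hvz
  obtain ⟨M', hM'⟩ := hS v hv
  obtain ⟨Y, Y', hYY', hY⟩ :=
    hM.exists_sub_one_eq hA hM' (hS0 z hz) (hS0 v hv) (hD z hz) (hD v hv)
  have hc3 : ‖v - z‖ * r ≤ 1 / 2 := by
    rw [lt_div_iff₀ (by positivity)] at hc2
    linarith
  have hP : ‖res A0 v‖ ≤ 2 * r := by
    have h1 : ‖v - z‖ * ‖res A0 z‖ ≤ 1 / 2 := by nlinarith [norm_nonneg (v - z)]
    linarith [(hS0 v hv).norm_le_two_mul (hS0 z hz) h1]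
  set c := v - z with hc
  set G := N * (1 + c • res A0 v) * (N * D z) with hGdef
  have hG : ‖G‖ ≤ g := by
    have h1 : ‖(1 : H →L[ℂ] H) + c • res A0 v‖ ≤ 1 + 2 * r := by
      refine (norm_add_le _ _).trans (add_le_add ContinuousLinearMap.norm_id_le ?_)
      rw [norm_smul]
      nlinarith [norm_nonneg c, norm_nonneg (res A0 v)]
    refine (norm_mul_le _ _).trans ?_
    rw [hg]
    gcongr
    · exact (norm_mul_le _ _).trans (by gcongr)
    · exact norm_mul_le _ _
  have hK := (hL.mul_left (1 + c • G)).smul c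
  have hdet : detI b (D v - 1) =
      detI b (D z - 1) * detI b (c • ((1 + c • G) * (res A z * (D z - 1)))) := by
    rw [hY, mul_assoc,
      ((((hT.add hK).add (hK.mul_left (D z - 1))).mul_right Y).detI_mul_comm Y' b),
      mul_assoc, hYY', mul_one, hT.detI_mul hK]
  have e : detI b (D v - 1) - detI b (D z - 1) -
      c • (detI b (D z - 1) * traceH b (res A z * (D z - 1))) =
      detI b (D z - 1) * (detI b (c • ((1 + c • G) * (res A z * (D z - 1)))) -
        (1 + c * traceH b (res A z * (D z - 1)))) := by
    rw [hdet, smul_eq_mul]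
    ring
  rw [e, norm_mul, mul_assoc]
  gcongr
  exact hL.norm_detI_smul_one_add_mul_sub_le hG b hc1

theorem sandwich_mul_one_sub_eq {N D R R0 : H →L[ℂ] H} (hN : N * N = R) (hD : N * D * N = R0) :
    R - R0 = -(N * (D - 1) * N) := by
  rw [← hN, ← hD]
  noncomm_ring

theorem TraceBound.traceH_sub_of_sandwich {N D R R0 : H →L[ℂ] H} {B : ℝ} (hN : N * N = R)
    (hD : N * D * N = R0) (hT : TraceBound (D - 1) B) (b : HilbertBasis ℕ ℂ H) :
    traceH b (R * (D - 1)) = -traceH b (R - R0) := by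
  rw [sandwich_mul_one_sub_eq hN hD, traceH_neg, neg_neg, ← hN, mul_assoc,
    (hT.mul_left N).traceH_mul_comm N b]

/-- Theorem 7.8: under Hypothesis (H), with
`D z = closure((A - z)^{1/2}(A₀ - z)⁻¹(A - z)^{1/2})` (characterized by
`(A - z)^{-1/2} (D z) (A - z)^{-1/2} = (A₀ - z)⁻¹`), the operator `D z - I` is trace
class, and wherever `D z` is boundedly invertible,
`-(d/dz) ln det(D z) = tr((A - z)⁻¹ - (A₀ - z)⁻¹)`, i.e. the derivative of
`z ↦ det(D z)` equals `-det(D z)·tr((A - z)⁻¹ - (A₀ - z)⁻¹)`. -/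
theorem statement7
    (A A0 : H →ₗ.[ℂ] H) (t0 ω0 t1 : ℝ) (b : HilbertBasis ℕ ℂ H)
    (hH : HypothesisH A A0 t0 ω0 t1)
    (D : ℂ → H →L[ℂ] H)
    (hD : ∀ z ∈ offSector t0 ω0,
      (negSqrt A z).comp ((D z).comp (negSqrt A z)) = res A0 z) :
    ∀ z ∈ offSector t0 ω0,
      IsTraceClass (D z - 1) ∧
      (IsUnit (D z) →
        IsTraceClass (res A z - res A0 z) ∧
        HasDerivWithinAt (fun w => detI b (D w - 1))
          (-(detI b (D z - 1) * traceH b (res A z - res A0 z))) (offSector t0 ω0) z) := by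
  obtain ⟨hA, -, -, -, h0, hπ, hpA, hpA0, hsA, hsA0, ht, -, -, D1, ⟨B, hB⟩, hD1⟩ := hH
  replace hB : TraceBound D1 B := hB
  obtain ⟨M, hM⟩ := hpA.exists_isRegularRay ht
  obtain ⟨M0, hM0⟩ := hpA0.exists_isRegularRay ht
  have hS : ∀ v ∈ offSector t0 ω0, ∃ M, IsRegularRay A v M := fun v hv =>
    hsA.exists_isRegularRay h0 hπ hv
  have hS0 : ∀ v ∈ offSector t0 ω0, IsResolvent A0 v (res A0 v) := fun v hv =>
    (hsA0.exists_isRegularRay h0 hπ hv).choose_spec.isResolvent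
  have hD' : ∀ v ∈ offSector t0 ω0, negSqrt A v * D v * negSqrt A v = res A0 v := fun v hv => by
    rw [mul_assoc]
    exact hD v hv
  have hbase : negSqrt A (-(t1 : ℂ)) * (1 - D1) * negSqrt A (-(t1 : ℂ)) = res A0 (-(t1 : ℂ)) := by
    have h1 : negSqrt A (-(t1 : ℂ)) * (D1 * negSqrt A (-(t1 : ℂ))) =
      res A (-(t1 : ℂ)) - res A0 (-(t1 : ℂ)) := hD1
    rw [mul_sub, sub_mul, mul_one, hM.negSqrt_mul_self, mul_assoc, h1, sub_sub_cancel]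
  have hT1 : IsTraceClass ((1 - D1) - 1) := by
    rw [sub_sub_cancel_left]
    exact hB.neg.isTraceClass
  intro z hz
  obtain ⟨M', hM'⟩ := hS z hz
  have htc : IsTraceClass (D z - 1) :=
    hM.isTraceClass_sub_one hA hM' hM0.isResolvent (hS0 z hz) hbase (hD' z hz) hT1
  refine ⟨htc, fun _ => ?_⟩
  obtain ⟨C, hC⟩ := htc
  replace hC : TraceBound (D z - 1) C := hC
  refine ⟨?_, ?_⟩
  · rw [sandwich_mul_one_sub_eq hM'.negSqrt_mul_self (hD' z hz)]
    exact ((hC.mul_left _).mul_right _).neg.isTraceClass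
  · have h := hasDerivWithinAt_detI_sub_one hA hS hS0 hD' hz hC b
    rwa [hC.traceH_sub_of_sandwich hM'.negSqrt_mul_self (hD' z hz), mul_neg] at h

end
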